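/- arXiv:math/9901122 — 3 statements merged into one kernel-verified Lean document; each statement's English description precedes it below -/
import Mathlib

section
/- Assume {g_{m,n}} with g_{m,n}(k) = g_m(k - na) is a shift-invariant frame for ℓ²(ℤ) with frame bounds A, B, ‖g_m‖ = 1, and each g_m compactly supported with g_m(k) = 0 for |k| > s. Let S be the frame operator, P_N the projection onto coordinates {-N,...,N}, S_N = P_N S P_N, γ_m = S^{-1} g_m and γ_m^{(N)} = S_N^{-1} P_N g_m. Then for N > 2s, ‖γ_m - γ_m^{(N)}‖ ≤ √2·C·λ^N·(λ^s - λ^{s+1})^{-3}, where κ = B/A, q = (√κ-1)/(√κ+1), λ = q^{1/(2s)}, and C = A^{-1}·max{2κ, (1+√κ)²}. In particular γ_m^{(N)} → γ_m exponentially fast in ℓ²(ℤ). -/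
noncomputable section

abbrev L2Z := lp (fun _ : ℤ => ℂ) 2

open Polynomial in
lemma fs_cheb_poly (A B q : ℝ) (hA : 0 < A) (hAB : A ≤ B)
    (hq : q = (Real.sqrt (B / A) - 1) / (Real.sqrt (B / A) + 1)) (k : ℕ) (hk : 1 ≤ k) :
    ∃ r : ℝ[X], r.eval 0 = 1 ∧ r.natDegree ≤ k ∧
      ∀ x, A ≤ x → x ≤ B → |r.eval x| ≤ 2 * q ^ k := by
  rcases hAB.eq_or_lt with h | h
  · subst h
    have hq0 : q = 0 := by rw [hq, div_self hA.ne']; simp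
    refine ⟨C (-A⁻¹) * X + C 1, by simp, (natDegree_linear_le).trans hk, ?_⟩
    intro x h1 h2
    have : x = A := le_antisymm h2 h1
    subst this
    rw [hq0, zero_pow (by omega)]
    simp [hA.ne']
  · set t := Real.sqrt (B / A) with ht
    have ht2 : t ^ 2 = B / A := Real.sq_sqrt (div_nonneg (hA.le.trans hAB) hA.le)
    have ht1 : 1 < t := by
      rw [ht]; apply Real.lt_sqrt_of_sq_lt; rw [one_pow, one_lt_div hA]; exact h
    have hq0 : 0 < q := by rw [hq]; apply div_pos <;> linarith
    have hB : B = t ^ 2 * A := by rw [ht2]; field_simp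
    have hBA : 0 < B - A := by linarith
    have hpt : (B + A) / (B - A) = Real.cosh (Real.log q) := by
      rw [Real.cosh_log hq0, hq, hB]
      have e1 : t - 1 ≠ 0 := by linarith
      have e2 : t + 1 ≠ 0 := by linarith
      have e3 : t ^ 2 * A - A ≠ 0 := by rw [← hB]; exact hBA.ne'
      have e4 : t ^ 2 - 1 ≠ 0 := by
        intro h0; apply e3; linear_combination A * h0
      rw [inv_div]
      field_simp
      ring
    have hT : (Chebyshev.T ℝ k).eval ((B + A) / (B - A)) = (q ^ k + (q ^ k)⁻¹) / 2 := by
      rw [hpt, Chebyshev.T_real_cosh]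
      rw [show ((k : ℤ) : ℝ) * Real.log q = Real.log (q ^ k) by rw [Real.log_pow]; simp]
      rw [Real.cosh_log (by positivity)]
    set τ := (Chebyshev.T ℝ k).eval ((B + A) / (B - A)) with hτ
    have hqk : 0 < q ^ k := by positivity
    have hτpos : 0 < τ := by rw [hT]; positivity
    refine ⟨C τ⁻¹ * (Chebyshev.T ℝ k).comp (C (-2 / (B - A)) * X + C ((B + A) / (B - A))),
      ?_, ?_, ?_⟩
    · simp [← hτ, hτpos.ne']
    · refine (natDegree_C_mul_le _ _).trans ?_
      rw [natDegree_comp, Chebyshev.natDegree_T]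
      simp only [Int.natAbs_natCast]
      calc k * _ ≤ k * 1 := Nat.mul_le_mul_left _ natDegree_linear_le
        _ = k := by simp
    · intro x h1 h2
      have hx : |-2 / (B - A) * x + (B + A) / (B - A)| ≤ 1 := by
        rw [show -2 / (B - A) * x + (B + A) / (B - A) = (B + A - 2 * x) / (B - A) by ring]
        rw [abs_div, abs_of_pos hBA, div_le_one hBA, abs_le]
        constructor <;> linarith
      have := Chebyshev.abs_eval_T_real_le_one k hx
      simp only [eval_mul, eval_C, eval_comp, eval_add, eval_X, abs_mul]
      rw [abs_of_pos (inv_pos.2 hτpos)]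
      calc _ ≤ τ⁻¹ * 1 := by gcongr
        _ ≤ ((q ^ k)⁻¹ / 2)⁻¹ := by
          rw [mul_one]
          apply inv_anti₀ (by positivity)
          rw [hT]; linarith
        _ = 2 * q ^ k := by field_simp

open Polynomial in
lemma fs_norm_aeval {H : Type*} [NormedAddCommGroup H] [InnerProductSpace ℂ H] [CompleteSpace H]
    (S : H →L[ℂ] H) (hS : IsSelfAdjoint S) (A B : ℝ)
    (h1 : ∀ f, A * ‖f‖ ^ 2 ≤ (inner ℂ (S f) f).re)
    (h2 : ∀ f, (inner ℂ (S f) f).re ≤ B * ‖f‖ ^ 2)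
    (r : ℝ[X]) (ε : ℝ) (hε : 0 ≤ ε) (hr : ∀ x, A ≤ x → x ≤ B → |r.eval x| ≤ ε) :
    ‖aeval S r‖ ≤ ε := by
  have key : ∀ (c : ℝ) (f : H), inner ℂ ((algebraMap ℝ (H →L[ℂ] H) c) f) f = ((c * ‖f‖ ^ 2 : ℝ) : ℂ) := by
    intro c f
    rw [Algebra.algebraMap_eq_smul_one]
    simp only [_root_.smul_apply, one_apply_eq_self]
    rw [← Complex.coe_smul, inner_smul_left, inner_self_eq_norm_sq_to_K]
    simp
  have sa : ∀ c : ℝ, IsSelfAdjoint (algebraMap ℝ (H →L[ℂ] H) c) := fun c =>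
    (IsSelfAdjoint.all c).algebraMap _
  have lo : algebraMap ℝ (H →L[ℂ] H) A ≤ S := by
    rw [ContinuousLinearMap.le_def, ContinuousLinearMap.isPositive_def']
    refine ⟨hS.sub (sa A), fun f => ?_⟩
    simp only [ContinuousLinearMap.reApplyInnerSelf, _root_.sub_apply, inner_sub_left,
      key]
    have := h1 f
    simp only [map_sub, RCLike.re_to_complex, Complex.ofReal_re]
    linarith
  have hi : S ≤ algebraMap ℝ (H →L[ℂ] H) B := by
    rw [ContinuousLinearMap.le_def, ContinuousLinearMap.isPositive_def']
    refine ⟨(sa B).sub hS, fun f => ?_⟩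
    simp only [ContinuousLinearMap.reApplyInnerSelf, _root_.sub_apply, inner_sub_left,
      key]
    have := h2 f
    simp only [map_sub, RCLike.re_to_complex, Complex.ofReal_re]
    linarith
  rw [algebraMap_le_iff_le_spectrum hS] at lo
  rw [le_algebraMap_iff_spectrum_le hS] at hi
  rw [← cfc_polynomial r S hS]
  exact norm_cfc_le hε fun x hx => hr x (lo x hx) (hi x hx)

lemma fs_analysis {ι : Type*} (G : ι → L2Z) (A B : ℝ) (hA : 0 < A)
    (hframe_low : ∀ f : L2Z, A * ‖f‖ ^ 2 ≤ ∑' p, ‖(inner (𝕜 := ℂ) (G p) f : ℂ)‖ ^ 2)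
    (hframe_up : ∀ f : L2Z, (∑' p, ‖(inner (𝕜 := ℂ) (G p) f : ℂ)‖ ^ 2) ≤ B * ‖f‖ ^ 2) :
    ∃ L : L2Z →L[ℂ] lp (fun _ : ι => ℂ) 2,
      (∀ f, ‖L f‖ ^ 2 = ∑' p, ‖(inner (𝕜 := ℂ) (G p) f : ℂ)‖ ^ 2) ∧
      ∀ f, HasSum (fun p => (inner (𝕜 := ℂ) (G p) f : ℂ) • G p)
        (ContinuousLinearMap.adjoint L (L f)) := by
  classical
  have hsum : ∀ f : L2Z, Summable fun p => ‖(inner (𝕜 := ℂ) (G p) f : ℂ)‖ ^ 2 := by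
    intro f
    by_cases hf : f = 0
    · subst hf; simp
    by_contra hns
    have := hframe_low f
    rw [tsum_eq_zero_of_not_summable hns] at this
    have h0 : 0 < ‖f‖ := norm_pos_iff.2 hf
    have : 0 < A * ‖f‖ ^ 2 := by positivity
    linarith
  have hmem : ∀ f : L2Z, Memℓp (E := fun _ : ι => ℂ) (fun p => (inner (𝕜 := ℂ) (G p) f : ℂ)) 2 := by
    intro f
    apply memℓp_gen
    simpa using hsum f
  let L0 : L2Z →ₗ[ℂ] lp (fun _ : ι => ℂ) 2 :=
    { toFun := fun f => ⟨fun p => (inner (𝕜 := ℂ) (G p) f : ℂ), hmem f⟩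
      map_add' := by
        intro f h; ext p; exact inner_add_right _ _ _
      map_smul' := by
        intro c f; ext p; exact inner_smul_right _ _ _ }
  have happ : ∀ f p, (L0 f : ι → ℂ) p = inner ℂ (G p) f := fun f p => rfl
  have hnorm : ∀ f, ‖L0 f‖ ^ 2 = ∑' p, ‖(inner (𝕜 := ℂ) (G p) f : ℂ)‖ ^ 2 := by
    intro f
    have := lp.norm_rpow_eq_tsum (p := 2) (by simp) (L0 f)
    simpa [happ] using this
  let L : L2Z →L[ℂ] lp (fun _ : ι => ℂ) 2 := L0.mkContinuous (Real.sqrt B) (by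
    intro f
    refine (sq_le_sq₀ (norm_nonneg _) (by positivity)).1 ?_
    rw [hnorm, mul_pow]
    have h := hframe_up f
    by_cases hf : f = 0
    · subst hf; simp
    have h0 : 0 < ‖f‖ ^ 2 := by have := norm_pos_iff.2 hf; positivity
    have hB : 0 ≤ B := by
      have h1 := hframe_low f
      have : 0 < B * ‖f‖ ^ 2 := lt_of_lt_of_le (by positivity) (h1.trans h)
      exact (pos_of_mul_pos_left this h0.le).le
    rw [Real.sq_sqrt hB]; exact h)
  refine ⟨L, hnorm, fun f => ?_⟩
  have hG : ∀ p, ∀ c : ℂ, ContinuousLinearMap.adjoint L (lp.single 2 p c) = c • G p := by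
    intro p c
    apply ext_inner_right ℂ
    intro h
    rw [ContinuousLinearMap.adjoint_inner_left, lp.inner_single_left, inner_smul_left]
    change inner ℂ c (inner ℂ (G p) h) = _
    simp [mul_comm]
  have h1 := (ContinuousLinearMap.adjoint L).hasSum (lp.hasSum_single (p := 2) (by simp) (L f))
  simpa [hG] using! h1

/-- sequences supported in `[-r, r]` -/
def fsV (r : ℕ) : Submodule ℂ L2Z where
  carrier := {f | ∀ k : ℤ, (r : ℤ) < |k| → f k = 0}
  add_mem' := by
    intro f h hf hh k hk
    rw [lp.coeFn_add, Pi.add_apply, hf k hk, hh k hk, add_zero]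
  zero_mem' := by intro k _; rfl
  smul_mem' := by
    intro c f hf k hk
    rw [lp.coeFn_smul, Pi.smul_apply, hf k hk, smul_zero]

lemma fsV_mono {r r' : ℕ} (h : r ≤ r') : fsV r ≤ fsV r' :=
  fun _ hf k hk => hf k (lt_of_le_of_lt (by exact_mod_cast h) hk)

lemma fs_band {M a s : ℕ} (g : Fin M → L2Z) (G : Fin M → ℤ → L2Z)
    (hG : ∀ (m : Fin M) (n k : ℤ), (G m n : ℤ → ℂ) k = (g m : ℤ → ℂ) (k - n * a))
    (hgsupp : ∀ (m : Fin M) (k : ℤ), (s : ℤ) < |k| → (g m : ℤ → ℂ) k = 0)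
    (f y : L2Z)
    (hy : HasSum (fun p : Fin M × ℤ => (inner (𝕜 := ℂ) (G p.1 p.2) f : ℂ) • G p.1 p.2) y)
    (r : ℕ) (hf : f ∈ fsV r) : y ∈ fsV (r + 2 * s) := by
  intro k hk
  have h1 := (lp.evalCLM ℂ (fun _ : ℤ => ℂ) 2 k).hasSum hy
  have h2 : ∀ p : Fin M × ℤ, (lp.evalCLM ℂ (fun _ : ℤ => ℂ) 2 k)
      ((inner (𝕜 := ℂ) (G p.1 p.2) f : ℂ) • G p.1 p.2) = 0 := by
    rintro ⟨m, n⟩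
    rw [map_smul]
    change _ • (G m n : ℤ → ℂ) k = 0
    by_cases hc : (s : ℤ) < |k - n * a|
    · rw [hG, hgsupp m _ hc, smul_zero]
    · have : inner ℂ (G m n) f = 0 := by
        rw [lp.inner_eq_tsum]
        convert! tsum_zero with j
        by_cases hj : (r : ℤ) < |j|
        · rw [hf j hj, inner_zero_right]
        · rw [hG, hgsupp m, inner_zero_left]
          push Not at hc hj
          rw [abs_le] at hc hj
          push_cast at hk
          rw [lt_abs] at hk ⊢
          rcases hk with hk | hk
          · right; linarith
          · left; linarith
      simp [this]
  have h3 : (lp.evalCLM ℂ (fun _ : ℤ => ℂ) 2 k) y = 0 := by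
    refine h1.unique ?_
    simp only [h2]
    exact hasSum_zero
  exact h3

open Polynomial in
lemma fs_poly_band {H : Type*} [NormedAddCommGroup H] [InnerProductSpace ℂ H]
    (V : ℕ → Submodule ℂ H) (hV : Monotone V) (S : H →L[ℂ] H) (s : ℕ)
    (hS : ∀ r f, f ∈ V r → S f ∈ V (r + 2 * s)) (p : ℝ[X]) (n : ℕ) (hp : p.natDegree ≤ n)
    (f : H) (r : ℕ) (hf : f ∈ V r) : (aeval S p) f ∈ V (r + 2 * s * n) := by
  have hpow : ∀ i : ℕ, (S ^ i) f ∈ V (r + 2 * s * i) := by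
    intro i
    induction i with
    | zero => simpa using hf
    | succ i ih =>
      rw [pow_succ']
      have := hS _ _ ih
      rw [show r + 2 * s * (i + 1) = r + 2 * s * i + 2 * s by ring]
      exact this
  rw [aeval_eq_sum_range, _root_.sum_apply]
  refine Submodule.sum_mem _ fun i hi => ?_
  rw [_root_.smul_apply, ← Complex.coe_smul]
  refine Submodule.smul_mem _ _ (hV ?_ (hpow i))
  have : i ≤ n := by rw [Finset.mem_range] at hi; omega
  gcongr


open Polynomial in
lemma fs_krylov {H : Type*} [NormedAddCommGroup H] [InnerProductSpace ℂ H] [CompleteSpace H]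
    (V : ℕ → Submodule ℂ H) (hV : Monotone V) (S : H →L[ℂ] H) (s : ℕ)
    (hSV : ∀ r f, f ∈ V r → S f ∈ V (r + 2 * s))
    (hS : IsSelfAdjoint S) (A B : ℝ)
    (h1 : ∀ f, A * ‖f‖ ^ 2 ≤ (inner ℂ (S f) f).re)
    (h2 : ∀ f, (inner ℂ (S f) f).re ≤ B * ‖f‖ ^ 2)
    (r : ℝ[X]) (ε : ℝ) (hε : 0 ≤ ε) (hr : ∀ x, A ≤ x → x ≤ B → |r.eval x| ≤ ε)
    (n : ℕ) (hdeg : r.natDegree ≤ n + 1) (hr0 : r.eval 0 = 1) (r0 : ℕ) (g γ : H)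
    (hg : g ∈ V r0) (hγ : S γ = g) :
    ∃ v ∈ V (r0 + 2 * s * n), ‖γ - v‖ ≤ ε * ‖γ‖ := by
  obtain ⟨p, hp⟩ : X ∣ (1 - r) := by
    rw [X_dvd_iff, coeff_zero_eq_eval_zero]; simp [hr0]
  have hpd : p.natDegree ≤ n := by
    by_cases h0 : p = 0
    · simp [h0]
    have e1 : (X * p).natDegree = p.natDegree + 1 := natDegree_X_mul h0
    have e2 : (1 - r).natDegree ≤ n + 1 :=
      (natDegree_sub_le _ _).trans (by simpa using hdeg)
    rw [hp, e1] at e2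
    omega
  refine ⟨aeval S p g, fs_poly_band V hV S s hSV p n hpd g r0 hg, ?_⟩
  have e : γ - aeval S p g = aeval S r γ := by
    have hr' : r = 1 - p * X := by rw [mul_comm, ← hp]; ring
    rw [hr']
    simp [hγ]
  rw [e]
  exact (ContinuousLinearMap.le_opNorm _ _).trans
    (by gcongr; exact fs_norm_aeval S hS A B h1 h2 r ε hε hr)

/-- Galerkin quasi-optimality. -/
lemma fs_galerkin {H K : Type*} [NormedAddCommGroup H] [InnerProductSpace ℂ H]
    [NormedAddCommGroup K] [InnerProductSpace ℂ K] (L : H →L[ℂ] K) (A B : ℝ) (hA : 0 < A)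
    (hAB : A ≤ B)
    (h1 : ∀ f, A * ‖f‖ ^ 2 ≤ ‖L f‖ ^ 2) (h2 : ∀ f, ‖L f‖ ^ 2 ≤ B * ‖f‖ ^ 2)
    (γ x v : H) (ho : inner ℂ (L (v - x)) (L (γ - x)) = 0) :
    ‖γ - x‖ ≤ Real.sqrt (B / A) * ‖γ - v‖ := by
  have e : inner ℂ (L (γ - x)) (L (γ - x)) = inner ℂ (L (γ - v)) (L (γ - x)) := by
    nth_rewrite 1 [show γ - x = (γ - v) + (v - x) by abel]
    rw [map_add, inner_add_left, ho, add_zero]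
  have e2 : ‖L (γ - x)‖ ^ 2 ≤ ‖L (γ - v)‖ * ‖L (γ - x)‖ := by
    have : ‖L (γ - x)‖ ^ 2 = ‖inner ℂ (L (γ - x)) (L (γ - x))‖ := by
      rw [inner_self_eq_norm_sq_to_K]; simp
    rw [this, e]
    exact norm_inner_le_norm _ _
  have e3 : ‖L (γ - x)‖ ≤ ‖L (γ - v)‖ := by
    rcases (norm_nonneg (L (γ - x))).eq_or_lt with h | h
    · rw [← h]; positivity
    · rw [sq] at e2; exact le_of_mul_le_mul_right e2 h
  have hBA : 0 ≤ B / A := div_nonneg (hA.le.trans hAB) hA.le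
  refine (sq_le_sq₀ (norm_nonneg _) (by positivity)).1 ?_
  rw [mul_pow, Real.sq_sqrt hBA]
  have e4 : ‖L (γ - x)‖ ^ 2 ≤ ‖L (γ - v)‖ ^ 2 := by gcongr
  have := (h1 (γ - x)).trans (e4.trans (h2 (γ - v)))
  rw [div_mul_eq_mul_div, le_div_iff₀ hA]
  linarith

lemma fs_final (A B κ q lam C : ℝ) (hA : 0 < A) (hAB : A ≤ B) (s N k : ℕ) (hs : 0 < s)
    (hN : 2 * s < N) (hk : N ≤ 2 * s * k + s)
    (hκ : κ = B / A) (hq : q = (Real.sqrt κ - 1) / (Real.sqrt κ + 1))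
    (hlam : lam = q ^ ((1 : ℝ) / (2 * s)))
    (hC : C = A⁻¹ * max (2 * κ) ((1 + Real.sqrt κ) ^ 2)) :
    Real.sqrt κ * ((2 * q ^ k) * A⁻¹) ≤
      Real.sqrt 2 * C * lam ^ (N : ℤ) * (lam ^ (s : ℤ) - lam ^ ((s : ℤ) + 1)) ^ (-3 : ℤ) := by
  have hκ1 : 1 ≤ κ := by rw [hκ, one_le_div hA]; exact hAB
  set t := Real.sqrt κ with ht
  have ht1 : 1 ≤ t := by rw [ht]; exact Real.one_le_sqrt.2 hκ1
  have hq0 : 0 ≤ q := by rw [hq]; apply div_nonneg <;> linarith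
  have hq1 : q < 1 := by rw [hq, div_lt_one (by linarith)]; linarith
  have hlq : lam ^ (2 * s) = q := by
    rw [hlam, ← Real.rpow_natCast, ← Real.rpow_mul hq0]
    push_cast
    rw [one_div_mul_cancel (by positivity), Real.rpow_one]
  have hl0 : 0 ≤ lam := by rw [hlam]; positivity
  have hl1 : lam < 1 := by
    by_contra h
    push Not at h
    have := one_le_pow₀ h (n := 2 * s)
    linarith
  have hkpos : k ≠ 0 := by
    rintro rfl; omega
  have hC0 : 0 ≤ C := by rw [hC]; positivity
  rcases hl0.eq_or_lt with h | h
  · have : q = 0 := by rw [← hlq, ← h, zero_pow (by omega)]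
    rw [this, zero_pow hkpos, ← h]
    rw [zero_zpow _ (by exact_mod_cast (by omega : N ≠ 0))]
    simp
  have hCt : 4 * t * A⁻¹ ≤ C := by
    rw [hC, mul_comm]
    gcongr
    refine le_trans ?_ (le_max_right _ _)
    nlinarith [sq_nonneg (t - 1)]
  have hmain : q ^ k ≤ lam ^ (N : ℤ) * (lam ^ (s : ℤ) - lam ^ ((s : ℤ) + 1)) ^ (-3 : ℤ) := by
    have e1 : lam ^ (s : ℤ) - lam ^ ((s : ℤ) + 1) = lam ^ s * (1 - lam) := by
      rw [zpow_add₀ h.ne', zpow_natCast, zpow_one]; ring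
    rw [e1, zpow_natCast, zpow_neg, ← div_eq_mul_inv]
    have h1l : 0 < 1 - lam := by linarith
    rw [le_div_iff₀ (by positivity)]
    have : (lam ^ s * (1 - lam)) ^ (3 : ℤ) ≤ lam ^ s := by
      rw [show (3 : ℤ) = ((3 : ℕ) : ℤ) by rfl, zpow_natCast]
      have b1 : lam ^ s * (1 - lam) ≤ lam ^ s := by
        apply mul_le_of_le_one_right (by positivity); linarith
      have b2 : lam ^ s ≤ 1 := pow_le_one₀ hl0 hl1.le
      calc (lam ^ s * (1 - lam)) ^ 3 ≤ (lam ^ s) ^ 3 := by gcongr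
        _ ≤ (lam ^ s) ^ 1 := pow_le_pow_of_le_one (by positivity) b2 (by norm_num)
        _ = lam ^ s := pow_one _
    calc q ^ k * (lam ^ s * (1 - lam)) ^ (3 : ℤ) ≤ q ^ k * lam ^ s := by gcongr
      _ = lam ^ (2 * s * k + s) := by rw [← hlq, ← pow_mul, ← pow_add]
      _ ≤ lam ^ N := pow_le_pow_of_le_one hl0 hl1.le hk
  have h2 : 1 ≤ Real.sqrt 2 := Real.one_le_sqrt.2 (by norm_num)
  have hAi : 0 < A⁻¹ := by positivity
  calc t * ((2 * q ^ k) * A⁻¹) = (2 * t * A⁻¹) * q ^ k := by ring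
    _ ≤ (Real.sqrt 2 * C) * q ^ k := by
      refine mul_le_mul_of_nonneg_right ?_ (by positivity)
      have h3 : 0 ≤ t * A⁻¹ := by positivity
      have h4 : 1 * C ≤ Real.sqrt 2 * C := mul_le_mul_of_nonneg_right h2 hC0
      linarith
    _ ≤ (Real.sqrt 2 * C) *
        (lam ^ (N : ℤ) * (lam ^ (s : ℤ) - lam ^ ((s : ℤ) + 1)) ^ (-3 : ℤ)) := by gcongr
    _ = _ := by ring

/-- Theorem 3.5(ii): for a shift-invariant frame `{g_{m,n}}` of ℓ²(ℤ)
with frame bounds `A,B`, normalized compactly supported generators (`g_m(k)=0` for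
`|k|>s`), the finite-section approximate duals `γ_m^{(N)} = S_N⁻¹ P_N g_m` converge
exponentially fast to the true duals `γ_m = S⁻¹ g_m`:
`‖γ_m - γ_m^{(N)}‖ ≤ √2 C λ^N (λ^s - λ^{s+1})^{-3}` for `N > 2s`, with
`κ = B/A`, `q = (√κ-1)/(√κ+1)`, `λ = q^{1/(2s)}`, `C = A⁻¹ max{2κ, (1+√κ)²}`. -/
theorem finite_section_rate_FIR
    (M a : ℕ) (hM : 0 < M) (ha : 0 < a)
    (g : Fin M → L2Z) (G : Fin M → ℤ → L2Z)
    (hG : ∀ (m : Fin M) (n k : ℤ), (G m n : ℤ → ℂ) k = (g m : ℤ → ℂ) (k - n * a))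
    (A B : ℝ) (hA : 0 < A) (hAB : A ≤ B)
    (hframe_low : ∀ f : L2Z,
      A * ‖f‖ ^ 2 ≤ ∑' p : Fin M × ℤ, ‖(inner (𝕜 := ℂ) (G p.1 p.2) f : ℂ)‖ ^ 2)
    (hframe_up : ∀ f : L2Z,
      (∑' p : Fin M × ℤ, ‖(inner (𝕜 := ℂ) (G p.1 p.2) f : ℂ)‖ ^ 2) ≤ B * ‖f‖ ^ 2)
    (S : L2Z →L[ℂ] L2Z)
    (hS : ∀ f : L2Z, S f = ∑' p : Fin M × ℤ, (inner (𝕜 := ℂ) (G p.1 p.2) f : ℂ) • G p.1 p.2)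
    (R : L2Z →L[ℂ] L2Z)
    (hR1 : R.comp S = ContinuousLinearMap.id ℂ L2Z)
    (hR2 : S.comp R = ContinuousLinearMap.id ℂ L2Z)
    (s : ℕ) (hs : 0 < s)
    (hgnorm : ∀ m : Fin M, ‖g m‖ = 1)
    (hgsupp : ∀ (m : Fin M) (k : ℤ), (s : ℤ) < |k| → (g m : ℤ → ℂ) k = 0)
    (N : ℕ) (hN : 2 * s < N)
    (P : L2Z →L[ℂ] L2Z)
    (hP : ∀ (f : L2Z) (k : ℤ), (P f : ℤ → ℂ) k = if |k| ≤ (N : ℤ) then f k else 0)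
    (SN : L2Z →L[ℂ] L2Z) (hSN : SN = P.comp (S.comp P))
    (TN : L2Z →L[ℂ] L2Z)
    (hTrange : ∀ x : L2Z, P (TN x) = TN x)
    (hT1 : ∀ x : L2Z, P x = x → SN (TN x) = x)
    (hT2 : ∀ x : L2Z, P x = x → TN (SN x) = x)
    (κ q lam C : ℝ)
    (hκ : κ = B / A) (hq : q = (Real.sqrt κ - 1) / (Real.sqrt κ + 1))
    (hlam : lam = q ^ ((1 : ℝ) / (2 * s)))
    (hC : C = A⁻¹ * max (2 * κ) ((1 + Real.sqrt κ) ^ 2)) :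
    ∀ m : Fin M,
      ‖R (g m) - TN (P (g m))‖ ≤
        Real.sqrt 2 * C * lam ^ (N : ℤ) * (lam ^ (s : ℤ) - lam ^ ((s : ℤ) + 1)) ^ (-3 : ℤ) := by
  intro m
  obtain ⟨L, hL, hLS⟩ := fs_analysis (fun p : Fin M × ℤ => G p.1 p.2) A B hA hframe_low hframe_up
  have hSL : S = (ContinuousLinearMap.adjoint L).comp L := by
    ext1 f
    rw [hS f]
    exact (hLS f).tsum_eq
  have hSum : ∀ f, HasSum (fun p : Fin M × ℤ => (inner (𝕜 := ℂ) (G p.1 p.2) f : ℂ) • G p.1 p.2)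
      (S f) := fun f => by rw [hSL]; exact hLS f
  have hin : ∀ f h, inner ℂ f (S h) = inner ℂ (L f) (L h) := by
    intro f h
    rw [hSL]
    exact ContinuousLinearMap.adjoint_inner_right L f (L h)
  have hin' : ∀ f, (inner ℂ (S f) f).re = ‖L f‖ ^ 2 := by
    intro f
    rw [← inner_conj_symm, hin, inner_self_eq_norm_sq_to_K, Complex.conj_re]
    norm_cast
  have hSsa : IsSelfAdjoint S := by
    rw [ContinuousLinearMap.isSelfAdjoint_iff_isSymmetric]
    intro f h
    change inner ℂ (S f) h = inner ℂ f (S h)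
    rw [hin, ← inner_conj_symm, hin, inner_conj_symm]
  have hlow : ∀ f, A * ‖f‖ ^ 2 ≤ ‖L f‖ ^ 2 := fun f => by rw [hL]; exact hframe_low f
  have hup : ∀ f, ‖L f‖ ^ 2 ≤ B * ‖f‖ ^ 2 := fun f => by rw [hL]; exact hframe_up f
  have hSV : ∀ r f, f ∈ fsV r → S f ∈ fsV (r + 2 * s) := fun r f hf =>
    fs_band g G hG hgsupp f (S f) (hSum f) r hf
  have hPV : ∀ f ∈ fsV N, P f = f := by
    intro f hf
    ext k
    rw [hP]
    split_ifs with hk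
    · rfl
    · exact (hf k (not_le.1 hk)).symm
  have hPin : ∀ f h, inner ℂ (P f) h = inner ℂ f (P h) := by
    intro f h
    rw [lp.inner_eq_tsum, lp.inner_eq_tsum]
    congr 1
    ext k
    rw [hP, hP]
    split_ifs <;> simp
  have hgV : g m ∈ fsV s := hgsupp m
  have hPg : P (g m) = g m := hPV _ (fsV_mono (by omega) hgV)
  set γ := R (g m) with hγ
  set x := TN (P (g m)) with hx
  have hSγ : S γ = g m := congrArg (fun T : L2Z →L[ℂ] L2Z => T (g m)) hR2
  have hPx : P x = x := hTrange _
  have hPSx : P (S x) = g m := by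
    have := hT1 (g m) hPg
    rw [hSN] at this
    simp only [ContinuousLinearMap.comp_apply] at this
    rw [hx, hPg]
    rw [hTrange] at this
    exact this
  have hγn : ‖γ‖ ≤ A⁻¹ := by
    have h1 := hlow γ
    rw [← hin', hSγ] at h1
    have h2 : (inner ℂ (g m) γ).re ≤ 1 * ‖γ‖ := by
      rw [← hgnorm m]
      exact (Complex.re_le_norm _).trans (norm_inner_le_norm _ _)
    rcases (norm_nonneg γ).eq_or_lt with h | h
    · rw [← h]; positivity
    · have h3 : (A * ‖γ‖) * ‖γ‖ ≤ 1 * ‖γ‖ := by nlinarith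
      have h4 := le_of_mul_le_mul_right h3 h
      rw [← one_div, le_div_iff₀ hA]; linarith
  obtain ⟨n, hn1, hn2⟩ : ∃ n : ℕ, s + 2 * s * n ≤ N ∧ N ≤ 2 * s * (n + 1) + s := by
    refine ⟨(N - s) / (2 * s), ?_, ?_⟩
    · have := Nat.mul_div_le (N - s) (2 * s)
      omega
    · have h1 := Nat.div_add_mod (N - s) (2 * s)
      have h2 := Nat.mod_lt (N - s) (show 0 < 2 * s by omega)
      rw [mul_add]
      omega
  obtain ⟨r, hr0, hrd, hr⟩ := fs_cheb_poly A B q hA hAB (by rw [← hκ]; exact hq) (n + 1) (by omega)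
  have hqn : 0 ≤ 2 * q ^ (n + 1) := (abs_nonneg _).trans (hr A le_rfl hAB)
  obtain ⟨v, hv, hvn⟩ := fs_krylov fsV (fun _ _ h => fsV_mono h) S s hSV hSsa A B
    (fun f => by rw [hin']; exact hlow f) (fun f => by rw [hin']; exact hup f)
    r _ hqn hr n hrd hr0 s (g m) γ hgV hSγ
  have hPv : P v = v := hPV v (fsV_mono hn1 hv)
  have ho : inner ℂ (L (v - x)) (L (γ - x)) = 0 := by
    rw [← hin]
    have h1 : P (v - x) = v - x := by rw [map_sub, hPv, hPx]
    rw [← h1, hPin, map_sub, hSγ, map_sub, hPg, hPSx, sub_self, inner_zero_right]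
  refine (fs_galerkin L A B hA hAB hlow hup γ x v ho).trans ?_
  refine le_trans ?_ (fs_final A B κ q lam C hA hAB s N (n + 1) hs hN hn2 hκ hq hlam hC)
  rw [← hκ]
  gcongr
  exact hvn.trans (by gcongr)
end
end

section
/- Assume {g_{m,n}} is a shift-invariant frame for ℓ²(ℤ) with frame bounds A, B, ‖g_m‖ = 1, and g_m(k) = 0 for |k| > s. Let ᴾγ_m^{(N)} = (ᴾS_N)^{-1} ᴾg_m be the dual computed in the periodic model of period 2N+1 (circulant shifts), and γ_m = S^{-1} g_m the true dual. Then for N > 3s, ‖P_N γ_m - ᴾγ_m^{(N)}‖ ≤ 3√2·C·λ^N·(λ^s - λ^{s+1})^{-3}, where κ = B/A, q = (√κ-1)/(√κ+1), λ = q^{1/(2s)}, and C = A^{-1}·max{2κ, (1+√κ)²}. -/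
noncomputable section

open Matrix
open scoped BigOperators

/-- Lower bound for Chebyshev polynomials outside `[-1,1]`. -/
lemma cheb_lower (q : ℝ) (hq : 0 < q) (n : ℕ) :
    (q ^ n)⁻¹ / 2 ≤ (Polynomial.Chebyshev.T ℝ (n : ℤ)).eval ((q + q⁻¹) / 2) := by
  have h1 : Real.cosh (Real.log q) = (q + q⁻¹) / 2 := Real.cosh_log hq
  rw [← h1, Polynomial.Chebyshev.T_real_cosh]
  have h2 : ((n : ℤ) : ℝ) * Real.log q = Real.log (q ^ n) := by
    rw [Real.log_pow]; push_cast; ring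
  rw [h2, Real.cosh_log (pow_pos hq n)]
  have := pow_pos hq n
  linarith

/-- Chebyshev residual polynomial: degree `n`, value one at zero, small at the operator. -/
lemma cheb_resid {E : Type*} [NormedAddCommGroup E] [InnerProductSpace ℂ E] [CompleteSpace E]
    (S : E →L[ℂ] E) (hS : IsSelfAdjoint S) (c d q : ℝ) (hd : 0 < d) (hq : 0 < q)
    (hcd : c / d = (q + q⁻¹) / 2)
    (hn : ‖S - algebraMap ℝ (E →L[ℂ] E) c‖ ≤ d) (n : ℕ) :
    ∃ Q : Polynomial ℝ, Q.natDegree ≤ n ∧ Q.coeff 0 = 1 ∧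
      ‖Polynomial.aeval S Q‖ ≤ 2 * q ^ n := by
  set t := (Polynomial.Chebyshev.T ℝ (n : ℤ)).eval (c / d) with ht
  have htl : (q ^ n)⁻¹ / 2 ≤ t := by rw [ht, hcd]; exact cheb_lower q hq n
  have hqn := pow_pos hq n
  have htpos : 0 < t := lt_of_lt_of_le (by positivity) htl
  set l : Polynomial ℝ := Polynomial.C (c / d) - Polynomial.C d⁻¹ * Polynomial.X with hl
  have hldeg : l.natDegree ≤ 1 := by
    rw [hl]; compute_degree
  refine ⟨Polynomial.C t⁻¹ * (Polynomial.Chebyshev.T ℝ (n : ℤ)).comp l, ?_, ?_, ?_⟩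
  · refine (Polynomial.natDegree_C_mul_le _ _).trans ?_
    refine Polynomial.natDegree_comp_le.trans ?_
    rw [Polynomial.Chebyshev.natDegree_T]
    simpa using Nat.mul_le_mul_left n hldeg
  · rw [Polynomial.coeff_zero_eq_eval_zero]
    simp [hl, Polynomial.eval_comp, ← ht, htpos.ne']
  · set X : E →L[ℂ] E := Polynomial.aeval S l with hX
    have hXe : X = d⁻¹ • (algebraMap ℝ (E →L[ℂ] E) c - S) := by
      simp only [hX, hl, map_sub, map_mul, Polynomial.aeval_C, Polynomial.aeval_X, smul_sub]
      rw [← Algebra.smul_def]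
      congr 1
      rw [Algebra.algebraMap_eq_smul_one, Algebra.algebraMap_eq_smul_one, smul_smul]
      congr 1; field_simp
    have hXn : ‖X‖ ≤ 1 := by
      rw [hXe, norm_smul, norm_sub_rev, Real.norm_of_nonneg (by positivity)]
      calc d⁻¹ * _ ≤ d⁻¹ * d := by gcongr
        _ = 1 := by field_simp
    have hXsa : IsSelfAdjoint X := by
      rw [hXe]
      exact IsSelfAdjoint.smul (.all _) ((IsSelfAdjoint.algebraMap _ (.all c)).sub hS)
    have hT : ‖Polynomial.aeval X (Polynomial.Chebyshev.T ℝ (n : ℤ))‖ ≤ 1 := by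
      rw [← cfc_polynomial (R := ℝ) (Polynomial.Chebyshev.T ℝ (n : ℤ)) X hXsa]
      refine norm_cfc_le zero_le_one fun x hx => ?_
      refine Polynomial.Chebyshev.abs_eval_T_real_le_one _ ?_
      have : ‖x‖ ≤ ‖X‖ * ‖(1 : E →L[ℂ] E)‖ := spectrum.norm_le_norm_mul_of_mem hx
      have h1 : ‖(1 : E →L[ℂ] E)‖ ≤ 1 := ContinuousLinearMap.norm_id_le
      calc |x| ≤ ‖X‖ * ‖(1 : E →L[ℂ] E)‖ := this
        _ ≤ 1 * 1 := by gcongr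
        _ = 1 := one_mul 1
    rw [map_mul, Polynomial.aeval_C, Polynomial.aeval_comp, ← hX, ← Algebra.smul_def, norm_smul,
      Real.norm_of_nonneg (by positivity)]
    calc t⁻¹ * _ ≤ t⁻¹ * 1 := by gcongr
      _ ≤ ((q ^ n)⁻¹ / 2)⁻¹ := by
        rw [mul_one]; exact inv_anti₀ (by positivity) htl
      _ = 2 * q ^ n := by field_simp

/-- Norm of a self-adjoint operator from its quadratic form. -/
lemma norm_sub_le_of_form {E : Type*} [NormedAddCommGroup E] [InnerProductSpace ℂ E]
    [CompleteSpace E] (S : E →L[ℂ] E) (hS : IsSelfAdjoint S) (A B : ℝ) (hAB : A ≤ B)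
    (h1 : ∀ f, A * ‖f‖ ^ 2 ≤ RCLike.re (inner ℂ (S f) f))
    (h2 : ∀ f, RCLike.re (inner ℂ (S f) f) ≤ B * ‖f‖ ^ 2) :
    ‖S - algebraMap ℝ (E →L[ℂ] E) ((A + B) / 2)‖ ≤ (B - A) / 2 := by
  have hsa : IsSelfAdjoint (S - algebraMap ℝ (E →L[ℂ] E) ((A + B) / 2)) :=
    hS.sub (IsSelfAdjoint.algebraMap _ (.all _))
  rw [ContinuousLinearMap.norm_eq_iSup_rayleighQuotient _
    (ContinuousLinearMap.isSelfAdjoint_iff_isSymmetric.mp hsa)]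
  refine Real.iSup_le (fun f => ?_) (by linarith)
  rw [ContinuousLinearMap.rayleighQuotient, ContinuousLinearMap.reApplyInnerSelf_apply]
  by_cases hf : f = 0
  · subst hf; simp; linarith
  have hf' : 0 < ‖f‖ ^ 2 := by positivity
  have e : RCLike.re (inner ℂ ((S - algebraMap ℝ (E →L[ℂ] E) ((A + B) / 2)) f) f) =
      RCLike.re (inner ℂ (S f) f) - (A + B) / 2 * ‖f‖ ^ 2 := by
    rw [Algebra.algebraMap_eq_smul_one]
    have : (((A + B) / 2 : ℝ) • (1 : E →L[ℂ] E)) f = (((A + B) / 2 : ℝ) : ℂ) • f := by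
      rw [Complex.coe_smul]; rfl
    rw [_root_.sub_apply, this, inner_sub_left, map_sub, inner_smul_left,
      inner_self_eq_norm_sq_to_K]
    congr 1
    rw [Complex.conj_ofReal]
    change ((((A + B) / 2 : ℝ) : ℂ) * ((‖f‖ : ℝ) : ℂ) ^ 2).re = _
    rw [← Complex.ofReal_pow, ← Complex.ofReal_mul, Complex.ofReal_re]
  rw [e, abs_div, abs_of_pos hf', div_le_iff₀ hf', abs_le]
  constructor <;> nlinarith [h1 f, h2 f]

lemma l2_norm_sq {ι : Type*} (f : lp (fun _ : ι => ℂ) 2) : ‖f‖ ^ 2 = ∑' i, ‖f i‖ ^ 2 := by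
  have := lp.norm_rpow_eq_tsum (p := 2) (by norm_num) f
  simpa using this

/-- Analysis operator of a Bessel sequence. -/
lemma exists_analysis {ι : Type*} [DecidableEq ι] {E : Type*} [NormedAddCommGroup E]
    [InnerProductSpace ℂ E]
    [CompleteSpace E] (G : ι → E) (A B : ℝ) (hA : 0 < A) (hAB : A ≤ B)
    (hl : ∀ f : E, A * ‖f‖ ^ 2 ≤ ∑' p, ‖(inner ℂ (G p) f : ℂ)‖ ^ 2)
    (hu : ∀ f : E, (∑' p, ‖(inner ℂ (G p) f : ℂ)‖ ^ 2) ≤ B * ‖f‖ ^ 2)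
    (S : E →L[ℂ] E) (hS : ∀ f, S f = ∑' p, (inner ℂ (G p) f : ℂ) • G p) :
    ∃ T : E →L[ℂ] lp (fun _ : ι => ℂ) 2, (∀ f p, T f p = inner ℂ (G p) f) ∧
      ∀ f h, inner ℂ h (S f) = inner ℂ (T h) (T f) := by
  have hsum : ∀ f : E, Summable fun p => ‖(inner ℂ (G p) f : ℂ)‖ ^ 2 := by
    intro f
    by_cases hf : f = 0
    · subst hf; simp
    by_contra hns
    have := hl f
    rw [tsum_eq_zero_of_not_summable hns] at this
    have : 0 < A * ‖f‖ ^ 2 := by positivity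
    linarith
  have hmem : ∀ f : E, Memℓp (fun p => (inner ℂ (G p) f : ℂ)) 2 := by
    intro f
    refine memℓp_gen ?_
    simpa using hsum f
  let T0 : E →ₗ[ℂ] lp (fun _ : ι => ℂ) 2 :=
    { toFun := fun f => ⟨fun p => inner ℂ (G p) f, hmem f⟩
      map_add' := by
        intro x y; ext p; simp; rfl
      map_smul' := by
        intro c x; ext p; simp }
  have hB : 0 ≤ B := by linarith
  have hbd : ∀ f, ‖T0 f‖ ≤ Real.sqrt B * ‖f‖ := by
    intro f
    refine le_of_sq_le_sq ?_ (by positivity)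
    rw [l2_norm_sq, mul_pow, Real.sq_sqrt hB]
    exact hu f
  let T := T0.mkContinuous _ hbd
  have hT : ∀ f p, T f p = inner ℂ (G p) f := fun f p => rfl
  refine ⟨T, hT, fun f h => ?_⟩
  have hadj : ∀ p (c : ℂ), ContinuousLinearMap.adjoint T (lp.single 2 p c) = c • G p := by
    intro p c
    refine ext_inner_right ℂ fun v => ?_
    rw [ContinuousLinearMap.adjoint_inner_left, lp.inner_single_left, hT, inner_smul_left]
    simp [mul_comm]
  have h1 := (lp.hasSum_single (p := 2) (by norm_num) (T f)).mapL (ContinuousLinearMap.adjoint T)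
  simp only [hadj, hT] at h1
  rw [hS f, h1.tsum_eq, ContinuousLinearMap.adjoint_inner_right]

/-- Restriction to `[-N,N]`. -/
def restr (N : ℕ) (f : L2Z) : EuclideanSpace ℂ (Fin (2 * N + 1)) :=
  WithLp.toLp 2 fun i => (f : ℤ → ℂ) ((i : ℤ) - N)

lemma restr_sub (N : ℕ) (f h : L2Z) : restr N (f - h) = restr N f - restr N h := by
  ext i; simp [restr]

lemma restr_norm (N : ℕ) (f : L2Z) : ‖restr N f‖ ≤ ‖f‖ := by
  refine le_of_sq_le_sq ?_ (norm_nonneg _)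
  rw [EuclideanSpace.norm_sq_eq]
  have hinj : Function.Injective (fun i : Fin (2 * N + 1) => (i : ℤ) - N) := by
    intro i j h; ext; simp at h; omega
  have := lp.sum_rpow_le_norm_rpow (p := 2) (by norm_num) f
    (Finset.univ.map ⟨fun i : Fin (2 * N + 1) => (i : ℤ) - N, hinj⟩)
  rw [Finset.sum_map] at this
  simpa [restr] using this

/-- Periodic operator agrees with `S` on vectors well inside. -/
lemma restr_apply (N s : ℕ) (S : L2Z →L[ℂ] L2Z)
    (PS : Matrix (Fin (2 * N + 1)) (Fin (2 * N + 1)) ℂ)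
    (hPSentries : ∀ i j : Fin (2 * N + 1), |(i : ℤ) - (j : ℤ)| < 2 * (N : ℤ) + 1 - 2 * s →
      PS i j = inner (𝕜 := ℂ) (lp.single 2 ((i : ℤ) - N) (1 : ℂ))
        (S (lp.single 2 ((j : ℤ) - N) (1 : ℂ))))
    (y : L2Z) (hy : ∀ k : ℤ, (N : ℤ) - 2 * s < |k| → (y : ℤ → ℂ) k = 0) :
    Matrix.toEuclideanCLM (𝕜 := ℂ) PS (restr N y) = restr N (S y) := by
  have hyS : y = ∑ j : Fin (2 * N + 1), (y : ℤ → ℂ) ((j : ℤ) - N) •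
      (lp.single 2 ((j : ℤ) - N) (1 : ℂ) : L2Z) := by
    ext k
    rw [lp.coeFn_sum, Finset.sum_apply]
    simp only [lp.coeFn_smul, Pi.smul_apply, lp.single_apply, smul_eq_mul, Pi.single_apply]
    by_cases hk : |k| ≤ N
    · have hk2 := abs_le.mp hk
      rw [Finset.sum_eq_single (⟨(k + N).toNat, by omega⟩ : Fin (2 * N + 1))]
      · have : (((k + N).toNat : ℕ) : ℤ) - N = k := by omega
        simp only [this, if_true, mul_one]
      · intro b _ hb
        rw [if_neg, mul_zero]
        intro h
        apply hb
        ext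
        simp only
        omega
      · simp
    · rw [hy k (by omega), Finset.sum_eq_zero]
      intro j _
      rw [if_neg, mul_zero]
      intro h
      apply hk
      rw [abs_le]
      omega
  ext i
  have e1 : (restr N (S y)).ofLp i =
      inner ℂ (lp.single 2 ((i : ℤ) - N) (1 : ℂ) : L2Z) (S y) := by
    rw [lp.inner_single_left]; simp [restr]
  rw [e1, Matrix.ofLp_toEuclideanCLM]
  conv_rhs => rw [hyS]
  rw [map_sum, inner_sum, Matrix.mulVec, dotProduct]
  refine Finset.sum_congr rfl fun j _ => ?_
  rw [map_smul, inner_smul_right, mul_comm]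
  show (y : ℤ → ℂ) ((j : ℤ) - N) * _ = _
  by_cases hj : (N : ℤ) - 2 * s < |(j : ℤ) - N|
  · rw [hy _ hj]; simp
  · rw [hPSentries]
    have := abs_le.mp (not_lt.mp hj)
    rw [abs_lt]
    omega

lemma algMap_real {E : Type*} [NormedAddCommGroup E] [InnerProductSpace ℂ E] (c : ℝ) :
    algebraMap ℂ (E →L[ℂ] E) c = algebraMap ℝ (E →L[ℂ] E) c := by
  rw [Algebra.algebraMap_eq_smul_one, Algebra.algebraMap_eq_smul_one, Complex.coe_smul]

lemma shift_apply {E : Type*} [NormedAddCommGroup E] [InnerProductSpace ℂ E] (S : E →L[ℂ] E)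
    (c d : ℝ) (h : ‖S - algebraMap ℝ (E →L[ℂ] E) c‖ ≤ d) (x : E) :
    ‖S x - (c : ℂ) • x‖ ≤ d * ‖x‖ := by
  have := ContinuousLinearMap.le_of_opNorm_le _ h x
  rw [← algMap_real, Algebra.algebraMap_eq_smul_one] at this
  exact this

/-- Norm bound of a shifted self-adjoint operator from a spectral inclusion. -/
lemma spec_norm {E F : Type*} [NormedAddCommGroup E] [InnerProductSpace ℂ E] [CompleteSpace E]
    [NormedAddCommGroup F] [InnerProductSpace ℂ F] [CompleteSpace F]
    (P : E →L[ℂ] E) (hsaP : IsSelfAdjoint P)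
    (S : F →L[ℂ] F) (hspec : spectrum ℂ P ⊆ spectrum ℂ S) (c d : ℝ) (hd : 0 ≤ d)
    (h : ‖S - algebraMap ℝ (F →L[ℂ] F) c‖ ≤ d) :
    ‖P - algebraMap ℝ (E →L[ℂ] E) c‖ ≤ d := by
  rw [← algMap_real] at h ⊢
  have hsa : IsSelfAdjoint (P - algebraMap ℂ (E →L[ℂ] E) c) :=
    hsaP.sub (IsSelfAdjoint.algebraMap _ (Complex.conj_ofReal c))
  have key := hsa.spectralRadius_eq_nnnorm
  have h2 : spectralRadius ℂ (P - algebraMap ℂ (E →L[ℂ] E) c) ≤ ENNReal.ofReal d := by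
    refine iSup₂_le fun z hz => ?_
    have hz1 : z + c ∈ spectrum ℂ P := by
      rw [← spectrum.sub_singleton_eq] at hz
      obtain ⟨w, hw, u, hu, rfl⟩ := hz
      rw [Set.mem_singleton_iff.mp hu]
      simpa using hw
    have hz2 := hspec hz1
    have hz3 : z ∈ spectrum ℂ (S - algebraMap ℂ (F →L[ℂ] F) c) := by
      rw [← spectrum.sub_singleton_eq]
      exact ⟨z + c, hz2, c, rfl, by ring⟩
    have hz4 := spectrum.norm_le_norm_mul_of_mem hz3
    have h1 : ‖(1 : F →L[ℂ] F)‖ ≤ 1 := ContinuousLinearMap.norm_id_le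
    have : ‖z‖ ≤ d := by
      calc ‖z‖ ≤ _ := hz4
        _ ≤ d * 1 := by gcongr
        _ = d := mul_one d
    rw [← enorm_eq_nnnorm, ← ofReal_norm]
    exact ENNReal.ofReal_le_ofReal this
  rw [key] at h2
  have := (ENNReal.le_ofReal_iff_toReal_le (by simp) hd).mp h2
  simpa using this

lemma PS_norm {n : ℕ} (PS : Matrix (Fin n) (Fin n) ℂ) (hPSherm : PS.IsHermitian)
    (S : L2Z →L[ℂ] L2Z) (hspec : spectrum ℂ PS ⊆ spectrum ℂ S) (c d : ℝ) (hd : 0 ≤ d)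
    (h : ‖S - algebraMap ℝ (L2Z →L[ℂ] L2Z) c‖ ≤ d) (x : EuclideanSpace ℂ (Fin n)) :
    ‖Matrix.toEuclideanCLM (𝕜 := ℂ) PS x - (c : ℂ) • x‖ ≤ d * ‖x‖ := by
  have hPs : spectrum ℂ (Matrix.toEuclideanCLM (𝕜 := ℂ) PS) = spectrum ℂ PS :=
    AlgEquiv.spectrum_eq (Matrix.toEuclideanCLM (𝕜 := ℂ)) PS
  have hsaP : IsSelfAdjoint (Matrix.toEuclideanCLM (𝕜 := ℂ) PS) := by
    have : IsSelfAdjoint PS := hPSherm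
    exact this.map (Matrix.toEuclideanCLM (𝕜 := ℂ))
  exact shift_apply _ c d (spec_norm _ hsaP S (by rw [hPs]; exact hspec) c d hd h) x

/-- Support growth under `S`. -/
lemma supp_S {M a s : ℕ} (g : Fin M → L2Z) (G : Fin M → ℤ → L2Z)
    (hG : ∀ (m : Fin M) (n k : ℤ), (G m n : ℤ → ℂ) k = (g m : ℤ → ℂ) (k - n * a))
    (hgsupp : ∀ (m : Fin M) (k : ℤ), (s : ℤ) < |k| → (g m : ℤ → ℂ) k = 0)
    (S : L2Z →L[ℂ] L2Z) (T : L2Z →L[ℂ] lp (fun _ : Fin M × ℤ => ℂ) 2)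
    (hT : ∀ f p, T f p = inner ℂ (G p.1 p.2) f)
    (hST : ∀ f h, inner ℂ h (S f) = inner ℂ (T h) (T f))
    (f : L2Z) (r : ℕ) (hf : ∀ k : ℤ, (r : ℤ) < |k| → (f : ℤ → ℂ) k = 0)
    (k : ℤ) (hk : ((r + 2 * s : ℕ) : ℤ) < |k|) : (S f : ℤ → ℂ) k = 0 := by
  have e1 : (S f : ℤ → ℂ) k = inner ℂ (lp.single 2 k (1 : ℂ) : L2Z) (S f) := by
    rw [lp.inner_single_left]; simp
  rw [e1, hST, lp.inner_eq_tsum]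
  convert tsum_zero with p
  rw [hT, hT, lp.inner_single_right, hG]
  by_cases h1 : (s : ℤ) < |k - p.2 * a|
  · simp [hgsupp p.1 _ h1]
  · have : inner ℂ (G p.1 p.2) f = 0 := by
      rw [lp.inner_eq_tsum]
      convert tsum_zero with j
      rw [hG]
      by_cases h2 : (s : ℤ) < |j - p.2 * a|
      · simp [hgsupp p.1 _ h2]
      · rw [hf j, inner_zero_right]
        rw [not_lt] at h1 h2
        push_cast at hk
        generalize p.2 * (a : ℤ) = b at *
        grind
    rw [this, inner_zero_right]

lemma supp_poly {s : ℕ} (S : L2Z →L[ℂ] L2Z)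
    (hS : ∀ (f : L2Z) (r : ℕ), (∀ k : ℤ, (r : ℤ) < |k| → (f : ℤ → ℂ) k = 0) →
      ∀ k : ℤ, ((r + 2 * s : ℕ) : ℤ) < |k| → (S f : ℤ → ℂ) k = 0)
    (f : L2Z) (r : ℕ) (hf : ∀ k : ℤ, (r : ℤ) < |k| → (f : ℤ → ℂ) k = 0)
    (p : Polynomial ℝ) (n : ℕ) (hp : p.natDegree ≤ n) (k : ℤ)
    (hk : ((r + 2 * s * n : ℕ) : ℤ) < |k|) : ((Polynomial.aeval S p) f : ℤ → ℂ) k = 0 := by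
  have hpow : ∀ j : ℕ, ∀ k : ℤ, ((r + 2 * s * j : ℕ) : ℤ) < |k| → ((S ^ j) f : ℤ → ℂ) k = 0 := by
    intro j
    induction j with
    | zero => simpa using hf
    | succ j ih =>
      intro k hk
      rw [pow_succ']
      refine hS _ (r + 2 * s * j) ih k ?_
      convert hk using 2
      ring
  rw [Polynomial.aeval_eq_sum_range, _root_.sum_apply, lp.coeFn_sum, Finset.sum_apply]
  refine Finset.sum_eq_zero fun j hj => ?_
  have hj' : j ≤ n := by
    have := Finset.mem_range.mp hj; omega
  rw [_root_.smul_apply]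
  have : ((S ^ j) f : ℤ → ℂ) k = 0 := by
    refine hpow j k (lt_of_le_of_lt ?_ hk)
    have : 2 * s * j ≤ 2 * s * n := Nat.mul_le_mul_left _ hj'
    omega
  rw [lp.coeFn_smul, Pi.smul_apply, this, smul_zero]

lemma bounds_of_shift {E : Type*} [NormedAddCommGroup E] [NormedSpace ℂ E]
    (S : E → E) (A B : ℝ) (hA : 0 < A) (hAB : A ≤ B)
    (h : ∀ x, ‖S x - (((A + B) / 2 : ℝ) : ℂ) • x‖ ≤ (B - A) / 2 * ‖x‖) (x : E) :
    A * ‖x‖ ≤ ‖S x‖ ∧ ‖S x‖ ≤ B * ‖x‖ := by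
  have h1 : ‖(((A + B) / 2 : ℝ) : ℂ) • x‖ = (A + B) / 2 * ‖x‖ := by
    rw [norm_smul, Complex.norm_real, Real.norm_of_nonneg (by linarith)]
  have h2 := h x
  have h3 := norm_sub_norm_le (S x) ((((A + B) / 2 : ℝ) : ℂ) • x)
  have h4 := norm_sub_norm_le ((((A + B) / 2 : ℝ) : ℂ) • x) (S x)
  rw [norm_sub_rev] at h4
  constructor <;> nlinarith

lemma final_numeric (A B κ q lam C X : ℝ) (s N m : ℕ) (hA : 0 < A) (hs : 0 < s)
    (hN : 3 * s < N) (hm : N - 3 * s ≤ 2 * s * m)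
    (hκ : κ = B / A) (hκ0 : 0 < κ) (hq0 : 0 < q) (hq1 : q < 1)
    (hlam : lam = q ^ ((1 : ℝ) / (2 * s)))
    (hC : C = A⁻¹ * max (2 * κ) ((1 + Real.sqrt κ) ^ 2))
    (hX : A * X ≤ 2 * B * (A⁻¹ * (2 * q ^ m))) :
    X ≤ 3 * Real.sqrt 2 * C * lam ^ (N : ℤ) *
            (lam ^ (s : ℤ) - lam ^ ((s : ℤ) + 1)) ^ (-3 : ℤ) := by
  have hs' : (0 : ℝ) < s := by exact_mod_cast hs
  have hl0 : 0 < lam := by rw [hlam]; exact Real.rpow_pos_of_pos hq0 _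
  have hl1 : lam < 1 := by
    rw [hlam]; exact Real.rpow_lt_one hq0.le hq1 (by positivity)
  have hlq : lam ^ (2 * s) = q := by
    rw [hlam, ← Real.rpow_natCast, ← Real.rpow_mul hq0.le]
    push_cast
    rw [one_div_mul_cancel (by positivity), Real.rpow_one]
  have hqm : q ^ m ≤ lam ^ (N - 3 * s) := by
    rw [← hlq, ← pow_mul]
    exact pow_le_pow_of_le_one hl0.le hl1.le hm
  have hCl : A⁻¹ * (2 * κ) ≤ C := by
    rw [hC]; gcongr; exact le_max_left _ _
  have hC0 : 0 < C := lt_of_lt_of_le (by positivity) hCl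
  have hX2 : X ≤ 2 * C * lam ^ (N - 3 * s) := by
    have : X ≤ 2 * (A⁻¹ * (2 * κ)) * q ^ m := by
      rw [hκ]
      rw [← le_div_iff₀' hA] at hX
      refine hX.trans (le_of_eq ?_)
      field_simp
    refine this.trans ?_
    gcongr
  refine hX2.trans ?_
  have e1 : lam ^ (N : ℤ) * (lam ^ (s : ℤ) - lam ^ ((s : ℤ) + 1)) ^ (-3 : ℤ) =
      lam ^ (N - 3 * s) * ((1 - lam) ^ 3)⁻¹ := by
    have h1 : lam ^ (s : ℤ) - lam ^ ((s : ℤ) + 1) = lam ^ s * (1 - lam) := by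
      rw [zpow_add₀ hl0.ne', zpow_natCast, zpow_one]; ring
    have h2 : lam ^ (N : ℤ) = lam ^ (N - 3 * s) * (lam ^ s) ^ 3 := by
      rw [zpow_natCast, ← pow_mul, ← pow_add]; congr 1; omega
    have h3 : (lam ^ s * (1 - lam)) ^ (-3 : ℤ) = ((lam ^ s * (1 - lam)) ^ 3)⁻¹ := by
      rw [_root_.zpow_neg]; norm_cast
    have h4 : 1 - lam ≠ 0 := by linarith
    rw [h1, h2, h3]
    field_simp
  rw [mul_assoc (3 * Real.sqrt 2 * C), e1]
  have h5 : 1 ≤ ((1 - lam) ^ 3)⁻¹ := by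
    refine (one_le_inv₀ (by have : 0 < 1 - lam := by linarith
                            positivity)).mpr ?_
    exact pow_le_one₀ (by linarith) (by linarith)
  have h6 : (1 : ℝ) ≤ Real.sqrt 2 := by
    rw [Real.one_le_sqrt]; norm_num
  have h7 : 2 * C ≤ 3 * Real.sqrt 2 * C := by nlinarith
  have h8 : lam ^ (N - 3 * s) ≤ lam ^ (N - 3 * s) * ((1 - lam) ^ 3)⁻¹ :=
    le_mul_of_one_le_right (by positivity) h5
  gcongr

/-- Stability of the periodic model: comparison with any vector supported well inside. -/
lemma stab (A B : ℝ) (N s : ℕ) (S : L2Z →L[ℂ] L2Z)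
    (PS PSinv : Matrix (Fin (2 * N + 1)) (Fin (2 * N + 1)) ℂ)
    (hinv : PS * PSinv = 1)
    (hPSentries : ∀ i j : Fin (2 * N + 1), |(i : ℤ) - (j : ℤ)| < 2 * (N : ℤ) + 1 - 2 * s →
      PS i j = inner (𝕜 := ℂ) (lp.single 2 ((i : ℤ) - N) (1 : ℂ))
        (S (lp.single 2 ((j : ℤ) - N) (1 : ℂ))))
    (hPb : ∀ x, A * ‖x‖ ≤ ‖Matrix.toEuclideanCLM (𝕜 := ℂ) PS x‖ ∧
      ‖Matrix.toEuclideanCLM (𝕜 := ℂ) PS x‖ ≤ B * ‖x‖)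
    (hSb : ∀ x, ‖S x‖ ≤ B * ‖x‖) (hB : 0 ≤ B)
    (γ g y : L2Z) (hγ : S γ = g)
    (hy : ∀ k : ℤ, (N : ℤ) - 2 * s < |k| → (y : ℤ → ℂ) k = 0) :
    A * Real.sqrt (∑ i : Fin (2 * N + 1),
            ‖(γ : ℤ → ℂ) ((i : ℤ) - N) -
              (PSinv *ᵥ (fun j : Fin (2 * N + 1) => (g : ℤ → ℂ) ((j : ℤ) - N))) i‖ ^ 2)
      ≤ 2 * B * ‖γ - y‖ := by
  set P := Matrix.toEuclideanCLM (𝕜 := ℂ) PS with hP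
  set e : EuclideanSpace ℂ (Fin (2 * N + 1)) :=
    restr N γ - Matrix.toEuclideanCLM (𝕜 := ℂ) PSinv (restr N g) with he
  have h1 : Real.sqrt (∑ i : Fin (2 * N + 1),
            ‖(γ : ℤ → ℂ) ((i : ℤ) - N) -
              (PSinv *ᵥ (fun j : Fin (2 * N + 1) => (g : ℤ → ℂ) ((j : ℤ) - N))) i‖ ^ 2) = ‖e‖ := by
    rw [EuclideanSpace.norm_eq]
    rfl
  rw [h1]
  refine (hPb e).1.trans ?_
  have h2 : P (Matrix.toEuclideanCLM (𝕜 := ℂ) PSinv (restr N g)) = restr N g := by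
    have : P * Matrix.toEuclideanCLM (𝕜 := ℂ) PSinv = 1 := by
      rw [hP, ← map_mul, hinv, map_one]
    exact congrArg (fun F => F (restr N g)) this
  have h3 : P (restr N y) = restr N (S y) := restr_apply N s S PS hPSentries y hy
  have h4 : P e = P (restr N (γ - y)) - restr N (S (γ - y)) := by
    rw [he, map_sub, h2, restr_sub, map_sub, h3, map_sub, restr_sub, hγ]
    abel
  rw [h4]
  calc _ ≤ ‖P (restr N (γ - y))‖ + ‖restr N (S (γ - y))‖ := norm_sub_le _ _
    _ ≤ B * ‖γ - y‖ + B * ‖γ - y‖ := by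
      refine add_le_add ((hPb _).2.trans ?_) ((restr_norm _ _).trans (hSb _))
      exact mul_le_mul_of_nonneg_left (restr_norm _ _) hB
    _ = _ := by ring

/-- Theorem 5.1: for a shift-invariant frame with compactly supported
normalized generators, the duals computed in the periodic (circulant) model of period
`2N+1` converge exponentially to the true duals:
`‖P_N γ_m - ᴾγ_m^{(N)}‖ ≤ 3√2 C λ^N (λ^s - λ^{s+1})^{-3}` for `N > 3s`.
The periodized frame operator `ᴾS_N` is a matrix on ℂ^{2N+1} (coordinates `k = i - N ∈
[-N,N]`) agreeing with the finite section `S_N` away from the two corner blocks, whose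
spectrum is contained in `σ(S)` (block circulant spectral inclusion). -/
theorem periodic_model_rate_FIR
    (M a : ℕ) (hM : 0 < M) (ha : 0 < a)
    (g : Fin M → L2Z) (G : Fin M → ℤ → L2Z)
    (hG : ∀ (m : Fin M) (n k : ℤ), (G m n : ℤ → ℂ) k = (g m : ℤ → ℂ) (k - n * a))
    (A B : ℝ) (hA : 0 < A) (hAB : A ≤ B)
    (hframe_low : ∀ f : L2Z,
      A * ‖f‖ ^ 2 ≤ ∑' p : Fin M × ℤ, ‖(inner (𝕜 := ℂ) (G p.1 p.2) f : ℂ)‖ ^ 2)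
    (hframe_up : ∀ f : L2Z,
      (∑' p : Fin M × ℤ, ‖(inner (𝕜 := ℂ) (G p.1 p.2) f : ℂ)‖ ^ 2) ≤ B * ‖f‖ ^ 2)
    (S : L2Z →L[ℂ] L2Z)
    (hS : ∀ f : L2Z, S f = ∑' p : Fin M × ℤ, (inner (𝕜 := ℂ) (G p.1 p.2) f : ℂ) • G p.1 p.2)
    (R : L2Z →L[ℂ] L2Z)
    (hR1 : R.comp S = ContinuousLinearMap.id ℂ L2Z)
    (hR2 : S.comp R = ContinuousLinearMap.id ℂ L2Z)
    (s : ℕ) (hs : 0 < s)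
    (hgnorm : ∀ m : Fin M, ‖g m‖ = 1)
    (hgsupp : ∀ (m : Fin M) (k : ℤ), (s : ℤ) < |k| → (g m : ℤ → ℂ) k = 0)
    (N : ℕ) (hN : 3 * s < N)
    (PS : Matrix (Fin (2 * N + 1)) (Fin (2 * N + 1)) ℂ)
    (hPSherm : PS.IsHermitian)
    -- ᴾS_N agrees with the finite section S_N away from the two corner blocks
    (hPSentries : ∀ i j : Fin (2 * N + 1), |(i : ℤ) - (j : ℤ)| < 2 * (N : ℤ) + 1 - 2 * s →
      PS i j = inner (𝕜 := ℂ) (lp.single 2 ((i : ℤ) - N) (1 : ℂ))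
        (S (lp.single 2 ((j : ℤ) - N) (1 : ℂ))))
    -- spectral inclusion for the block circulant periodized frame operator
    (hspec : spectrum ℂ PS ⊆ spectrum ℂ S)
    (κ q lam C : ℝ)
    (hκ : κ = B / A) (hq : q = (Real.sqrt κ - 1) / (Real.sqrt κ + 1))
    (hlam : lam = q ^ ((1 : ℝ) / (2 * s)))
    (hC : C = A⁻¹ * max (2 * κ) ((1 + Real.sqrt κ) ^ 2)) :
    ∃ PSinv : Matrix (Fin (2 * N + 1)) (Fin (2 * N + 1)) ℂ,
      PS * PSinv = 1 ∧ PSinv * PS = 1 ∧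
      ∀ m : Fin M,
        Real.sqrt (∑ i : Fin (2 * N + 1),
            ‖(R (g m) : ℤ → ℂ) ((i : ℤ) - N) -
              (PSinv *ᵥ (fun j : Fin (2 * N + 1) => (g m : ℤ → ℂ) ((j : ℤ) - N))) i‖ ^ 2) ≤
          3 * Real.sqrt 2 * C * lam ^ (N : ℤ) *
            (lam ^ (s : ℤ) - lam ^ ((s : ℤ) + 1)) ^ (-3 : ℤ) := by
  obtain ⟨T, hT, hST⟩ := exists_analysis (fun p : Fin M × ℤ => G p.1 p.2) A B hA hAB
    hframe_low hframe_up S hS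
  have hB : 0 < B := lt_of_lt_of_le hA hAB
  have hsa : IsSelfAdjoint S := by
    rw [ContinuousLinearMap.isSelfAdjoint_iff_isSymmetric]
    intro x y
    change inner ℂ (S x) y = inner ℂ x (S y)
    rw [hST, ← inner_conj_symm, hST, inner_conj_symm]
  have hform : ∀ f, RCLike.re (inner ℂ (S f) f) =
      ∑' p : Fin M × ℤ, ‖(inner (𝕜 := ℂ) (G p.1 p.2) f : ℂ)‖ ^ 2 := by
    intro f
    rw [← inner_conj_symm, RCLike.conj_re, hST, inner_self_eq_norm_sq, l2_norm_sq]
    simp only [hT]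
  have hSn : ‖S - algebraMap ℝ (L2Z →L[ℂ] L2Z) ((A + B) / 2)‖ ≤ (B - A) / 2 :=
    norm_sub_le_of_form S hsa A B hAB (fun f => by rw [hform]; exact hframe_low f)
      (fun f => by rw [hform]; exact hframe_up f)
  have hSx := shift_apply S _ _ hSn
  have hPx := PS_norm PS hPSherm S hspec ((A + B) / 2) ((B - A) / 2) (by linarith) hSn
  have hSb := bounds_of_shift (fun x => S x) A B hA hAB hSx
  have hPb := bounds_of_shift (fun x => Matrix.toEuclideanCLM (𝕜 := ℂ) PS x) A B hA hAB hPx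
  have hunit : IsUnit PS := by
    rw [← Matrix.mulVec_injective_iff_isUnit]
    intro x y hxy
    have h1 := (hPb (WithLp.toLp 2 (x - y))).1
    have h2 : Matrix.toEuclideanCLM (𝕜 := ℂ) PS (WithLp.toLp 2 (x - y)) = 0 := by
      rw [Matrix.toEuclideanCLM_toLp, Matrix.mulVec_sub]
      rw [hxy, sub_self]; rfl
    simp only [h2, norm_zero] at h1
    have h3 : ‖(WithLp.toLp 2 (x - y) : EuclideanSpace ℂ (Fin (2 * N + 1)))‖ = 0 := by
      have := norm_nonneg (WithLp.toLp 2 (x - y) : EuclideanSpace ℂ (Fin (2 * N + 1)))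
      nlinarith
    rw [norm_eq_zero] at h3
    have h4 : x - y = 0 := congrArg WithLp.ofLp h3
    exact sub_eq_zero.mp h4
  have hdet : IsUnit PS.det := (Matrix.isUnit_iff_isUnit_det _).mp hunit
  refine ⟨PS⁻¹, Matrix.mul_nonsing_inv _ hdet, Matrix.nonsing_inv_mul _ hdet, fun m => ?_⟩
  have hγ : S (R (g m)) = g m := congrArg (fun F => F (g m)) hR2
  have hstab := fun y hy => stab A B N s S PS PS⁻¹ (Matrix.mul_nonsing_inv _ hdet) hPSentries
    hPb (fun x => (hSb x).2) hB.le (R (g m)) (g m) y hγ hy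
  have hκ1 : 1 ≤ κ := by rw [hκ, le_div_iff₀ hA]; linarith
  rcases hAB.eq_or_lt with heq | hlt
  · -- tight frame
    have hq0 : q = 0 := by
      rw [hq, hκ, ← heq, div_self hA.ne']; simp
    have hs' : (0 : ℝ) < s := by exact_mod_cast hs
    have hl0 : lam = 0 := by
      rw [hlam, hq0, Real.zero_rpow (by positivity)]
    have hRHS : lam ^ (N : ℤ) = 0 := by
      rw [hl0, _root_.zero_zpow _ (by omega)]
    rw [hRHS]
    have h1 := hSx (R (g m))
    have hdz : (B - A) / 2 = 0 := by rw [heq]; simp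
    rw [hdz, zero_mul, norm_le_zero_iff, sub_eq_zero, hγ] at h1
    have h2 := hstab (R (g m)) (by
      intro k hk
      have h3 : (g m : ℤ → ℂ) k = 0 := hgsupp m k (by omega)
      rw [h1] at h3
      rw [lp.coeFn_smul, Pi.smul_apply, smul_eq_mul] at h3
      rcases mul_eq_zero.mp h3 with h | h
      · exfalso
        have : (A + B) / 2 = 0 := Complex.ofReal_eq_zero.mp h
        linarith
      · exact h)
    rw [sub_self, norm_zero, mul_zero] at h2
    have h5 := nonpos_of_mul_nonpos_right h2 hA
    simpa using h5
  · set r := Real.sqrt κ with hr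
    have hκ1' : 1 < κ := by rw [hκ, lt_div_iff₀ hA]; linarith
    have hr1 : 1 < r := by rw [hr, Real.lt_sqrt (by norm_num)]; simpa using hκ1'
    have hr2 : r ^ 2 = κ := Real.sq_sqrt (by linarith)
    have hBA : B = A * r ^ 2 := by rw [hr2, hκ]; field_simp
    have hq0 : 0 < q := by rw [hq]; exact div_pos (by linarith) (by linarith)
    have hq1 : q < 1 := by rw [hq, div_lt_one (by linarith)]; linarith
    have hcd : ((A + B) / 2) / ((B - A) / 2) = (q + q⁻¹) / 2 := by
      have e1 : r - 1 ≠ 0 := by linarith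
      have e2 : r + 1 ≠ 0 := by linarith
      have e3 : r ^ 2 - 1 ≠ 0 := by nlinarith
      have e4 : A * r ^ 2 - A ≠ 0 := by nlinarith
      rw [hq, hBA]
      field_simp
      ring
    obtain ⟨n, hn1, hn2⟩ : ∃ n, 2 * s * n ≤ N - 3 * s ∧ N - 3 * s ≤ 2 * s * (n + 1) :=
      ⟨(N - 3 * s) / (2 * s), Nat.mul_div_le _ _,
        (Nat.lt_mul_div_succ (N - 3 * s) (by omega : 0 < 2 * s)).le⟩
    obtain ⟨Q, hQd, hQ0, hQn⟩ := cheb_resid S hsa ((A + B) / 2) ((B - A) / 2) q (by linarith) hq0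
      hcd hSn (n + 1)
    have hQe : Q = 1 - Polynomial.X * (-Q.divX) := by
      conv_lhs => rw [← Polynomial.X_mul_divX_add Q, hQ0]
      simp; ring
    set y : L2Z := Polynomial.aeval S (-Q.divX) (g m) with hy
    have hysupp : ∀ k : ℤ, (N : ℤ) - 2 * s < |k| → (y : ℤ → ℂ) k = 0 := by
      intro k hk
      refine supp_poly S (supp_S g G hG hgsupp S T hT hST) (g m) s (hgsupp m) _ n ?_ k ?_
      · rw [Polynomial.natDegree_neg, Polynomial.natDegree_divX_eq_natDegree_tsub_one]; omega
      · refine lt_of_le_of_lt ?_ hk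
        have : s + 2 * s * n ≤ N - 2 * s := by omega
        omega
    have hSy : S (R (g m) - y) = Polynomial.aeval S Q (g m) := by
      rw [map_sub, hγ]
      conv_rhs => rw [hQe]
      rw [map_sub, map_mul, map_one, Polynomial.aeval_X]
      rfl
    have hdiff : ‖R (g m) - y‖ ≤ A⁻¹ * (2 * q ^ (n + 1)) := by
      have h1 := (hSb (R (g m) - y)).1
      simp only [hSy] at h1
      have h2 := ContinuousLinearMap.le_of_opNorm_le _ hQn (g m)
      rw [hgnorm, mul_one] at h2
      rw [inv_mul_eq_div, le_div_iff₀' hA]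
      exact h1.trans h2
    refine final_numeric A B κ q lam C _ s N (n + 1) hA hs hN hn2 hκ (by linarith) hq0 hq1 hlam hC ?_
    refine (hstab y hysupp).trans ?_
    gcongr
end
end

section
/- Let S be a bounded invertible positive operator on ℓ²(ℤ) satisfying A·I ≤ S ≤ B·I with A > 0, and suppose its matrix entries satisfy |S_{k,l}| ≤ c·λ₀^{|k-l|} for some λ₀ ∈ (0,1). Then the entries of the square root S^{1/2} and of S^{-1/2} also decay exponentially off the diagonal: there exist μ ∈ (0,1) and C' > 0 such that |(S^{1/2})_{k,l}| ≤ C'·μ^{|k-l|} and |(S^{-1/2})_{k,l}| ≤ C'·μ^{|k-l|} for all k,l ∈ ℤ. -/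
noncomputable section

namespace SqrtDecay

lemma choose_succ_eq (a : ℝ) (n : ℕ) :
    Ring.choose a (n + 1) = Ring.choose a n * ((a - n) / (n + 1)) := by
  rw [Ring.choose_eq_smul, Ring.choose_eq_smul, descPochhammer_succ_right,
    Polynomial.smeval_mul, Polynomial.smeval_sub, Polynomial.smeval_X, Polynomial.smeval_natCast,
    Nat.factorial_succ]
  have : ((n.factorial : ℕ) : ℝ) ≠ 0 := by positivity
  have h2 : (n : ℝ) + 1 ≠ 0 := by positivity
  simp only [smul_eq_mul, Nat.cast_mul, pow_one, pow_zero, nsmul_eq_mul, mul_one]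
  push_cast
  field_simp

lemma abs_choose_le {a : ℝ} (h0 : -1 ≤ a) (h1 : a ≤ 1) (n : ℕ) : |Ring.choose a n| ≤ 1 := by
  induction n with
  | zero => simp
  | succ n ih =>
    rw [choose_succ_eq, abs_mul]
    have hn : (0 : ℝ) ≤ n := by positivity
    have : |(a - n) / (n + 1)| ≤ 1 := by
      rw [abs_div, abs_of_pos (by positivity : (0 : ℝ) < n + 1), div_le_one (by positivity), abs_le]
      constructor <;> linarith
    exact mul_le_one₀ ih (abs_nonneg _) this

section banach
variable {𝔸 : Type*} [NormedRing 𝔸] [NormedAlgebra ℂ 𝔸] [CompleteSpace 𝔸]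

def F (x : 𝔸) (a : ℝ) : 𝔸 := ∑' n : ℕ, ((Ring.choose a n : ℝ) : ℂ) • x ^ n

lemma norm_term_le [NormOneClass 𝔸] {a : ℝ} (h0 : -1 ≤ a) (h1 : a ≤ 1) (x : 𝔸) (n : ℕ) :
    ‖((Ring.choose a n : ℝ) : ℂ) • x ^ n‖ ≤ ‖x‖ ^ n := by
  rw [norm_smul, Complex.norm_real, Real.norm_eq_abs]
  calc _ ≤ 1 * ‖x‖ ^ n :=
        mul_le_mul (abs_choose_le h0 h1 n) (norm_pow_le x n) (norm_nonneg _) zero_le_one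
    _ = _ := one_mul _

lemma summable_norm_term [NormOneClass 𝔸] {a : ℝ} (h0 : -1 ≤ a) (h1 : a ≤ 1) {x : 𝔸}
    (hx : ‖x‖ < 1) : Summable fun n : ℕ => ‖((Ring.choose a n : ℝ) : ℂ) • x ^ n‖ :=
  Summable.of_nonneg_of_le (fun _ => norm_nonneg _) (norm_term_le h0 h1 x)
    (summable_geometric_of_lt_one (norm_nonneg _) hx)

lemma hasSum_F [NormOneClass 𝔸] {a : ℝ} (h0 : -1 ≤ a) (h1 : a ≤ 1) {x : 𝔸}
    (hx : ‖x‖ < 1) : HasSum (fun n : ℕ => ((Ring.choose a n : ℝ) : ℂ) • x ^ n) (F x a) :=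
  (summable_norm_term h0 h1 hx).of_norm.hasSum

lemma F_mul [NormOneClass 𝔸] {a b : ℝ} (h0 : -1 ≤ a) (h1 : a ≤ 1) (h0' : -1 ≤ b) (h1' : b ≤ 1)
    {x : 𝔸} (hx : ‖x‖ < 1) : F x a * F x b = F x (a + b) := by
  unfold F
  rw [tsum_mul_tsum_eq_tsum_sum_antidiagonal_of_summable_norm (summable_norm_term h0 h1 hx)
    (summable_norm_term h0' h1' hx)]
  congr 1
  ext n
  rw [Ring.add_choose_eq n (Commute.all a b), Complex.ofReal_sum, Finset.sum_smul]
  refine Finset.sum_congr rfl fun ij hij => ?_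
  rw [← Finset.HasAntidiagonal.mem_antidiagonal.1 hij, pow_add, smul_mul_smul_comm, Complex.ofReal_mul]

lemma F_zero (x : 𝔸) : F x 0 = 1 := by
  unfold F
  rw [tsum_eq_single 0]
  · simp
  · intro n hn
    rw [Ring.choose_zero_pos ℝ (Nat.pos_of_ne_zero hn), Complex.ofReal_zero, zero_smul]

lemma F_one (x : 𝔸) : F x 1 = 1 + x := by
  unfold F
  rw [tsum_eq_sum (s := Finset.range 2)]
  · simp [Finset.sum_range_succ]
  · intro n hn
    have h := Ring.choose_natCast (R := ℝ) 1 n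
    rw [Nat.cast_one] at h
    rw [h, Nat.choose_eq_zero_of_lt (by simpa using hn)]
    simp

end banach

/-- matrix entry -/
def ent (T : L2Z →L[ℂ] L2Z) (k l : ℤ) : ℂ :=
  inner ℂ (lp.single 2 k (1 : ℂ) : L2Z) (T (lp.single 2 l (1 : ℂ)))

lemma norm_e (k : ℤ) : ‖(lp.single 2 k (1 : ℂ) : L2Z)‖ = 1 := by
  rw [lp.norm_single (by norm_num)]; simp

lemma norm_ent_le (T : L2Z →L[ℂ] L2Z) (k l : ℤ) : ‖ent T k l‖ ≤ ‖T‖ := by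
  unfold ent
  refine (norm_inner_le_norm _ _).trans ?_
  rw [norm_e, one_mul]
  refine (T.le_opNorm _).trans ?_
  rw [norm_e, mul_one]

/-- the entry as a continuous linear functional -/
def entL (k l : ℤ) : (L2Z →L[ℂ] L2Z) →L[ℂ] ℂ :=
  (innerSL ℂ (lp.single 2 k (1 : ℂ) : L2Z)).comp
    (ContinuousLinearMap.apply ℂ L2Z (lp.single 2 l (1 : ℂ) : L2Z))

lemma entL_apply (k l : ℤ) (T) : entL k l T = ent T k l := rfl

lemma ent_mul (P Q : L2Z →L[ℂ] L2Z) (k l : ℤ) :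
    HasSum (fun m => ent P k m * ent Q m l) (ent (P * Q) k l) := by
  have h := lp.hasSum_single (E := fun _ : ℤ => ℂ) (p := 2) (by norm_num)
    (Q (lp.single 2 l (1 : ℂ)))
  have h2 := ((innerSL ℂ (lp.single 2 k (1 : ℂ) : L2Z)).comp P).hasSum h
  have e : (fun m => ent P k m * ent Q m l) = fun m =>
      ((innerSL ℂ (lp.single 2 k (1 : ℂ) : L2Z)).comp P)
        (lp.single 2 m ((Q (lp.single 2 l (1 : ℂ))) m)) := by
    ext m
    have : (lp.single 2 m ((Q (lp.single 2 l (1 : ℂ))) m) : L2Z)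
        = (Q (lp.single 2 l (1 : ℂ))) m • (lp.single 2 m (1 : ℂ) : L2Z) := by
      rw [← lp.single_smul]; simp
    rw [this, map_smul, smul_eq_mul, mul_comm]
    congr 1
    unfold ent
    rw [lp.inner_single_left]
    simp
  rw [e]
  exact h2

lemma ent_one_le {μ : ℝ} (h0 : 0 < μ) (k l : ℤ) : ‖ent 1 k l‖ ≤ μ ^ (k - l).natAbs := by
  by_cases h : k = l
  · subst h
    refine (norm_ent_le _ _ _).trans ?_
    rw [sub_self, Int.natAbs_zero, pow_zero]
    exact ContinuousLinearMap.norm_id_le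
  · unfold ent
    rw [lp.inner_single_left]
    have : ((1 : L2Z →L[ℂ] L2Z) (lp.single 2 l (1 : ℂ))) k = 0 := by
      simp [lp.single_apply, h]
    rw [this]
    simp only [inner_zero_right, norm_zero]
    positivity

lemma summable_natAbs {μ : ℝ} (h0 : 0 < μ) (h1 : μ < 1) :
    Summable fun m : ℤ => μ ^ m.natAbs := by
  apply Summable.of_nat_of_neg <;> simpa using summable_geometric_of_lt_one h0.le h1


lemma pow_decay {X : L2Z →L[ℂ] L2Z} {K μ : ℝ} (h0 : 0 < μ) (h1 : μ < 1) (hK : 0 ≤ K)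
    (hX : ∀ k l, ‖ent X k l‖ ≤ K * (μ ^ 2) ^ (k - l).natAbs) (n : ℕ) (k l : ℤ) :
    ‖ent (X ^ n) k l‖ ≤ (K * ∑' m : ℤ, μ ^ m.natAbs) ^ n * μ ^ (k - l).natAbs := by
  have hG : 0 ≤ ∑' m : ℤ, μ ^ m.natAbs := tsum_nonneg fun m => by positivity
  induction n generalizing k l with
  | zero => simpa using ent_one_le h0 k l
  | succ n ih =>
    rw [pow_succ]
    have hs : HasSum (fun m : ℤ => μ ^ (m - l).natAbs) (∑' m : ℤ, μ ^ m.natAbs) :=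
      (Equiv.hasSum_iff (f := fun m : ℤ => μ ^ m.natAbs) (Equiv.subRight l)).2
        (summable_natAbs h0 h1).hasSum
    refine ((ent_mul (X ^ n) X k l).norm_le_of_bounded
      (hs.mul_left ((K * ∑' m : ℤ, μ ^ m.natAbs) ^ n * K * μ ^ (k - l).natAbs))
      fun m => ?_).trans (le_of_eq (by ring))
    rw [norm_mul]
    have key : μ ^ (k - m).natAbs * μ ^ (m - l).natAbs ≤ μ ^ (k - l).natAbs := by
      rw [← pow_add]
      exact pow_le_pow_of_le_one h0.le h1.le (by omega)
    calc _ ≤ ((K * ∑' m : ℤ, μ ^ m.natAbs) ^ n * μ ^ (k - m).natAbs) *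
          (K * (μ ^ 2) ^ (m - l).natAbs) :=
          mul_le_mul (ih k m) (hX m l) (norm_nonneg _) (by positivity)
      _ = (K * ∑' m : ℤ, μ ^ m.natAbs) ^ n * K * (μ ^ (k - m).natAbs * μ ^ (m - l).natAbs)
          * μ ^ (m - l).natAbs := by rw [← pow_mul, mul_comm 2, pow_mul]; ring
      _ ≤ _ := by gcongr

lemma exists_interp {r K μ : ℝ} (hr0 : 0 ≤ r) (hr1 : r < 1) (hK : 0 ≤ K) (h0 : 0 < μ)
    (h1 : μ < 1) : ∃ s t : ℝ, 0 < s ∧ s < 1 ∧ 0 < t ∧ t < 1 ∧ ∀ (E : ℝ) (n d : ℕ), 0 ≤ E →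
      E ≤ r ^ n → E ≤ K ^ n * μ ^ d → E ≤ s ^ n * t ^ d := by
  obtain ⟨N, hN⟩ : ∃ N : ℕ, r ^ N * K ≤ 1 / 2 := by
    have : Filter.Tendsto (fun N : ℕ => r ^ N * K) Filter.atTop (nhds (0 * K)) :=
      (tendsto_pow_atTop_nhds_zero_of_lt_one hr0 hr1).mul_const K
    rw [zero_mul] at this
    exact (this.eventually_le_const (by norm_num : (0 : ℝ) < 1 / 2)).exists
  have root : ∀ y : ℝ, 0 < y → y < 1 → ∃ s : ℝ, 0 < s ∧ s < 1 ∧ s ^ (N + 1) = y := by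
    intro y hy hy1
    refine ⟨y ^ (((N + 1 : ℕ) : ℝ)⁻¹), by positivity,
      Real.rpow_lt_one hy.le hy1 (by positivity), Real.rpow_inv_natCast_pow hy.le (by omega)⟩
  obtain ⟨s, hs0, hs1, hs⟩ := root (1 / 2) (by norm_num) (by norm_num)
  obtain ⟨t, ht0, ht1, ht⟩ := root μ h0 h1
  refine ⟨s, t, hs0, hs1, ht0, ht1, fun E n d hE hE1 hE2 => ?_⟩
  refine le_of_pow_le_pow_left₀ (n := N + 1) (by omega) (by positivity) ?_
  calc E ^ (N + 1) = E ^ N * E := pow_succ _ _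
    _ ≤ (r ^ n) ^ N * (K ^ n * μ ^ d) := by gcongr
    _ = (r ^ N * K) ^ n * μ ^ d := by rw [mul_pow, ← pow_mul, ← pow_mul, mul_comm n N]; ring
    _ ≤ (1 / 2) ^ n * μ ^ d := by gcongr
    _ = _ := by rw [← hs, ← ht, mul_pow, ← pow_mul, ← pow_mul, ← pow_mul, ← pow_mul,
                  mul_comm n, mul_comm d]

instance : Nontrivial L2Z :=
  ⟨⟨lp.single 2 0 (1 : ℂ), 0, fun h => by have := norm_e 0; rw [h] at this; simp at this⟩⟩

lemma F_decay {X : L2Z →L[ℂ] L2Z} (hx : ‖X‖ < 1) {K lam : ℝ} (h0 : 0 < lam) (h1 : lam < 1)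
    (hK : 0 ≤ K) (hX : ∀ k l, ‖ent X k l‖ ≤ K * lam ^ (k - l).natAbs) :
    ∃ t C : ℝ, 0 < t ∧ t < 1 ∧ 0 < C ∧ ∀ a : ℝ, -1 ≤ a → a ≤ 1 → ∀ k l,
      ‖ent (F X a) k l‖ ≤ C * t ^ (k - l).natAbs := by
  have hG : 0 ≤ ∑' m : ℤ, (√lam) ^ m.natAbs := tsum_nonneg fun m => by positivity
  have hm0 : 0 < √lam := Real.sqrt_pos.2 h0
  have hm1 : √lam < 1 := by rw [Real.sqrt_lt' one_pos]; simpa using h1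
  obtain ⟨s, t, hs0, hs1, ht0, ht1, H⟩ := exists_interp (norm_nonneg X) hx
    (mul_nonneg hK hG) hm0 hm1
  refine ⟨t, (1 - s)⁻¹, ht0, ht1, by simpa using hs1, fun a ha0 ha1 k l => ?_⟩
  have hF := (entL k l).hasSum (hasSum_F ha0 ha1 hx)
  rw [entL_apply] at hF
  refine hF.norm_le_of_bounded
    ((hasSum_geometric_of_lt_one hs0.le hs1).mul_right (t ^ (k - l).natAbs)) fun n => ?_
  rw [map_smul, entL_apply, norm_smul, Complex.norm_real, Real.norm_eq_abs]
  refine (mul_le_of_le_one_left (norm_nonneg _) (abs_choose_le ha0 ha1 n)).trans ?_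
  refine H _ n _ (norm_nonneg _) ((norm_ent_le _ _ _).trans (norm_pow_le X n)) ?_
  refine pow_decay hm0 hm1 hK ?_ n k l
  rw [Real.sq_sqrt h0.le]
  exact hX

section hilbert
variable {H : Type*} [NormedAddCommGroup H] [InnerProductSpace ℂ H] [CompleteSpace H]

lemma F_selfAdjoint {X : H →L[ℂ] H} (hX : IsSelfAdjoint X) (a : ℝ) :
    IsSelfAdjoint (F X a) := by
  unfold F IsSelfAdjoint
  rw [tsum_star]
  congr 1
  ext1 n
  rw [star_smul, star_pow, hX.star_eq]
  simp

lemma nonneg_of {T : H →L[ℂ] H} (h : IsSelfAdjoint T)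
    (hp : ∀ x : H, 0 ≤ (inner ℂ x (T x)).re) : 0 ≤ T := by
  rw [ContinuousLinearMap.nonneg_iff_isPositive, ContinuousLinearMap.isPositive_def']
  refine ⟨h, fun x => ?_⟩
  rw [ContinuousLinearMap.reApplyInnerSelf, inner_re_symm]
  exact hp x

lemma sa_real_smul {T : H →L[ℂ] H} (h : IsSelfAdjoint T) (b : ℝ) :
    IsSelfAdjoint ((b : ℂ) • T) :=
  IsSelfAdjoint.smul (Complex.conj_ofReal b) h

lemma core [Nontrivial H] (S : H →L[ℂ] H) (hSA : IsSelfAdjoint S)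
    (A B : ℝ) (hA : 0 < A) (hAB : A ≤ B)
    (hlow : ∀ x : H, A * ‖x‖ ^ 2 ≤ (inner (𝕜 := ℂ) x (S x)).re)
    (hup : ∀ x : H, (inner (𝕜 := ℂ) x (S x)).re ≤ B * ‖x‖ ^ 2)
    (sq : H →L[ℂ] H) (hsqA : IsSelfAdjoint sq)
    (hsqpos : ∀ x : H, 0 ≤ (inner (𝕜 := ℂ) x (sq x)).re)
    (hsq : sq * sq = S)
    (isq : H →L[ℂ] H)
    (hisq1 : isq * sq = 1) :
    ‖((B⁻¹ : ℝ) : ℂ) • S - 1‖ < 1 ∧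
    sq = ((√B : ℝ) : ℂ) • F (((B⁻¹ : ℝ) : ℂ) • S - 1) (1 / 2) ∧
    isq = (((√B)⁻¹ : ℝ) : ℂ) • F (((B⁻¹ : ℝ) : ℂ) • S - 1) (-1 / 2) := by
  have hB : 0 < B := hA.trans_le hAB
  set X : H →L[ℂ] H := ((B⁻¹ : ℝ) : ℂ) • S - 1 with hXdef
  have hXsa : IsSelfAdjoint X := (sa_real_smul hSA B⁻¹).sub (.one _)
  have hin : ∀ x : H, (inner ℂ x (X x)).re = B⁻¹ * (inner ℂ x (S x)).re - ‖x‖ ^ 2 := by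
    intro x
    have : X x = ((B⁻¹ : ℝ) : ℂ) • S x - x := rfl
    rw [this, inner_sub_right, inner_smul_right, inner_self_eq_norm_sq_to_K,
      Complex.sub_re, Complex.re_ofReal_mul]
    simp [← Complex.ofReal_pow]
  have hr0 : 0 ≤ 1 - A / B := by rw [sub_nonneg, div_le_one hB]; exact hAB
  have hr1 : 1 - A / B < 1 := by have := div_pos hA hB; linarith
  have hnX : 0 ≤ -X := by
    refine nonneg_of hXsa.neg fun x => ?_
    have h1 : B⁻¹ * (inner ℂ x (S x)).re ≤ B⁻¹ * (B * ‖x‖ ^ 2) :=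
      mul_le_mul_of_nonneg_left (hup x) (by positivity)
    rw [inv_mul_cancel_left₀ hB.ne'] at h1
    have h2 := hin x
    have : (inner ℂ x ((-X) x)).re = - (inner ℂ x (X x)).re := by
      rw [neg_apply, inner_neg_right, Complex.neg_re]
    rw [this]; linarith
  have hXn : ‖X‖ < 1 := by
    refine lt_of_le_of_lt ?_ hr1
    rw [← norm_neg, CStarAlgebra.norm_le_iff_le_algebraMap _ hr0 hnX, ← sub_nonneg]
    refine nonneg_of (IsSelfAdjoint.sub ?_ hXsa.neg) fun x => ?_
    · rw [Algebra.algebraMap_eq_smul_one]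
      exact (IsSelfAdjoint.all _).smul (.one _)
    · have h1 : B⁻¹ * (A * ‖x‖ ^ 2) ≤ B⁻¹ * (inner ℂ x (S x)).re :=
        mul_le_mul_of_nonneg_left (hlow x) (by positivity)
      have h2 := hin x
      have e : (algebraMap ℝ (H →L[ℂ] H) (1 - A / B) - -X) x = (1 - A / B) • x + X x := by
        rw [Algebra.algebraMap_eq_smul_one]
        simp
      rw [e, inner_add_right, inner_smul_right_eq_smul, inner_self_eq_norm_sq_to_K]
      have : (((1 - A / B) • ((‖x‖ : ℂ)) ^ 2 + inner ℂ x (X x)) : ℂ).re =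
          (1 - A / B) * ‖x‖ ^ 2 + (inner ℂ x (X x)).re := by
        simp [← Complex.ofReal_pow]
      refine le_of_le_of_eq ?_ this.symm
      rw [h2]
      have : B⁻¹ * (A * ‖x‖ ^ 2) = A / B * ‖x‖ ^ 2 := by ring
      linarith
  have hsB : 0 < √B := Real.sqrt_pos.2 hB
  have hFF : F X (1 / 2) * F X (1 / 2) = ((B⁻¹ : ℝ) : ℂ) • S := by
    rw [F_mul (by norm_num) (by norm_num) (by norm_num) (by norm_num) hXn]
    norm_num [F_one, hXdef]
  have hFi : F X (1 / 2) * F X (-1 / 2) = 1 := by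
    rw [F_mul (by norm_num) (by norm_num) (by norm_num) (by norm_num) hXn]
    norm_num [F_zero]
  have hFpos : 0 ≤ F X (1 / 2) := by
    have h4 : F X (1 / 4) * F X (1 / 4) = F X (1 / 2) := by
      rw [F_mul (by norm_num) (by norm_num) (by norm_num) (by norm_num) hXn]
      norm_num
    rw [← h4]
    exact (F_selfAdjoint hXsa (1 / 4)).mul_self_nonneg
  have hsqe : sq = ((√B : ℝ) : ℂ) • F X (1 / 2) := by
    have h1 : CFC.sqrt S = sq := CFC.sqrt_unique hsq (nonneg_of hsqA hsqpos)
    have h2 : CFC.sqrt S = ((√B : ℝ) : ℂ) • F X (1 / 2) := by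
      refine CFC.sqrt_unique ?_ ?_
      swap
      · rw [Complex.coe_smul]
        exact smul_nonneg hsB.le hFpos
      rw [smul_mul_smul_comm, hFF, ← Complex.ofReal_mul, Real.mul_self_sqrt hB.le, smul_smul,
        ← Complex.ofReal_mul, mul_inv_cancel₀ hB.ne', Complex.ofReal_one, one_smul]
    rw [← h1, h2]
  have hisqe : isq = (((√B)⁻¹ : ℝ) : ℂ) • F X (-1 / 2) := by
    refine left_inv_eq_right_inv (a := sq) hisq1 ?_
    rw [hsqe, smul_mul_smul_comm, hFi, ← Complex.ofReal_mul, mul_inv_cancel₀ hsB.ne',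
      Complex.ofReal_one, one_smul]
  exact ⟨hXn, hsqe, hisqe⟩

end hilbert

end SqrtDecay

/-- if `S` on ℓ²(ℤ) satisfies `A·I ≤ S ≤ B·I` with `A > 0` and its
matrix entries decay exponentially off the diagonal, then the entries of the
positive square root `S^{1/2}` and of `S^{-1/2}` also decay exponentially off the
diagonal. -/
theorem sqrt_exponential_offdiagonal_decay
    (S : L2Z →L[ℂ] L2Z) (hSA : IsSelfAdjoint S)
    (A B : ℝ) (hA : 0 < A) (hAB : A ≤ B)
    (hlow : ∀ x : L2Z, A * ‖x‖ ^ 2 ≤ (inner (𝕜 := ℂ) x (S x)).re)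
    (hup : ∀ x : L2Z, (inner (𝕜 := ℂ) x (S x)).re ≤ B * ‖x‖ ^ 2)
    (c lam₀ : ℝ) (hc : 0 < c) (hlam₀ : 0 < lam₀) (hlam₀1 : lam₀ < 1)
    (hdecay : ∀ k l : ℤ,
      ‖(inner (𝕜 := ℂ) (lp.single 2 k (1 : ℂ)) (S (lp.single 2 l (1 : ℂ))) : ℂ)‖ ≤
        c * lam₀ ^ (|k - l| : ℤ))
    -- sq is the unique positive square root S^{1/2}, isq its inverse S^{-1/2}
    (sq : L2Z →L[ℂ] L2Z) (hsqA : IsSelfAdjoint sq)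
    (hsqpos : ∀ x : L2Z, 0 ≤ (inner (𝕜 := ℂ) x (sq x)).re)
    (hsq : sq.comp sq = S)
    (isq : L2Z →L[ℂ] L2Z)
    (hisq1 : isq.comp sq = ContinuousLinearMap.id ℂ L2Z)
    (hisq2 : sq.comp isq = ContinuousLinearMap.id ℂ L2Z) :
    ∃ μ C' : ℝ, μ ∈ Set.Ioo (0 : ℝ) 1 ∧ 0 < C' ∧
      ∀ k l : ℤ,
        ‖(inner (𝕜 := ℂ) (lp.single 2 k (1 : ℂ)) (sq (lp.single 2 l (1 : ℂ))) : ℂ)‖ ≤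
          C' * μ ^ (|k - l| : ℤ) ∧
        ‖(inner (𝕜 := ℂ) (lp.single 2 k (1 : ℂ)) (isq (lp.single 2 l (1 : ℂ))) : ℂ)‖ ≤
          C' * μ ^ (|k - l| : ℤ) := by
  have hB : 0 < B := hA.trans_le hAB
  have hsB : 0 < √B := Real.sqrt_pos.2 hB
  obtain ⟨hXn, hsqe, hisqe⟩ := SqrtDecay.core S hSA A B hA hAB hlow hup sq hsqA hsqpos hsq isq hisq1
  set X : L2Z →L[ℂ] L2Z := ((B⁻¹ : ℝ) : ℂ) • S - 1 with hXdef
  have hXd : ∀ k l, ‖SqrtDecay.ent X k l‖ ≤ (B⁻¹ * c + 1) * lam₀ ^ (k - l).natAbs := by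
    intro k l
    have e : SqrtDecay.ent X k l = ((B⁻¹ : ℝ) : ℂ) • SqrtDecay.ent S k l - SqrtDecay.ent 1 k l := by
      rw [← SqrtDecay.entL_apply, hXdef, map_sub, map_smul]
      rfl
    have h1 := SqrtDecay.ent_one_le hlam₀ k l
    have h2 : ‖SqrtDecay.ent S k l‖ ≤ c * lam₀ ^ (k - l).natAbs := by
      have := hdecay k l
      rwa [Int.abs_eq_natAbs, zpow_natCast] at this
    rw [e]
    refine (norm_sub_le _ _).trans ?_
    rw [norm_smul, Complex.norm_real, Real.norm_of_nonneg (by positivity)]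
    have h3 := mul_le_mul_of_nonneg_left h2 (by positivity : 0 ≤ B⁻¹)
    linarith
  obtain ⟨t, C, ht0, ht1, hC, H⟩ := SqrtDecay.F_decay hXn hlam₀ hlam₀1 (by positivity) hXd
  have hfin : ∀ (b a : ℝ), 0 < b → -1 ≤ a → a ≤ 1 → ∀ k l : ℤ,
      ‖SqrtDecay.ent ((b : ℂ) • SqrtDecay.F X a) k l‖ ≤ b * C * t ^ |k - l| := by
    intro b a hb h0 h1 k l
    have e : SqrtDecay.ent ((b : ℂ) • SqrtDecay.F X a) k l = (b : ℂ) • SqrtDecay.ent (SqrtDecay.F X a) k l :=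
      (SqrtDecay.entL k l).map_smul _ _
    rw [e, norm_smul, Complex.norm_real, Real.norm_of_nonneg hb.le, Int.abs_eq_natAbs, zpow_natCast, mul_assoc]
    exact mul_le_mul_of_nonneg_left (H a h0 h1 k l) hb.le
  refine ⟨t, (√B + (√B)⁻¹) * C, ⟨ht0, ht1⟩, by positivity, fun k l => ⟨?_, ?_⟩⟩
  · have := hfin (√B) (1 / 2) hsB (by norm_num) (by norm_num) k l
    rw [← hsqe] at this
    refine this.trans ?_
    gcongr
    exact le_add_of_nonneg_right (by positivity)
  · have := hfin (√B)⁻¹ (-1 / 2) (by positivity) (by norm_num) (by norm_num) k l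
    rw [← hisqe] at this
    refine this.trans ?_
    gcongr
    exact le_add_of_nonneg_left (by positivity)
end
end
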